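/- A Banach space X is not superreflexive if and only if there exists a constant D ≥ 1 such that for every integer n ≥ 2 the lamplighter group G_n = Z_2 ≀ Z_n with the word metric ρ with respect to the generating set {t, ta} admits a bilipschitz embedding into X with distortion at most D. -/

import Mathlib

open scoped symmDiff

/-- Elements of the lamplighter group `Z₂ ≀ Z_n`: a set of lit lamps and a position. -/
abbrev Lamp (n : ℕ) := Set (ZMod n) × ZMod n

/-- Group multiplication `(x,g)·(y,h) = (x △ (g+y), g+h)`. -/
def lampMul {n : ℕ} (u v : Lamp n) : Lamp n :=
  (u.1 ∆ ((u.2 + ·) '' v.1), u.2 + v.2)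

/-- Group inverse in the lamplighter group. -/
def lampInv {n : ℕ} (u : Lamp n) : Lamp n :=
  ((· - u.2) '' u.1, -u.2)

/-- The generator `t = (∅, 1)`. -/
def lampT (n : ℕ) : Lamp n := (∅, 1)

/-- The generator `a = ({0}, 0)`. -/
def lampA (n : ℕ) : Lamp n := ({0}, 0)

/-- The generator `ta`. -/
def lampTA (n : ℕ) : Lamp n := lampMul (lampT n) (lampA n)

/-- Word metric w.r.t. a generating set `S`: the least `m` such that `u⁻¹v`
is a product of `m` elements of `S ∪ S⁻¹`, i.e. `v = u·s₁⋯s_m`. -/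
noncomputable def wordDist {n : ℕ} (S : Set (Lamp n)) (u v : Lamp n) : ℕ :=
  sInf {m | ∃ w : List (Lamp n), w.length = m ∧
    (∀ s ∈ w, s ∈ S ∨ ∃ g ∈ S, s = lampInv g) ∧ v = w.foldl lampMul u}

/-- The word metric `ρ` on `Z₂ ≀ Z_n` w.r.t. the generating set `{t, ta}`. -/
noncomputable def lampDist (n : ℕ) (u v : Lamp n) : ℕ :=
  wordDist {lampT n, lampTA n} u v

/-- Length of the longest common prefix of two vertices of the binary tree. -/
def lgc : List Bool → List Bool → ℕ
  | a :: as, b :: bs => if a = b then lgc as bs + 1 else 0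
  | _, _ => 0

/-- Graph distance in the binary tree (vertices = `{0,1}`-sequences). -/
def treeDist (A B : List Bool) : ℕ := A.length + B.length - 2 * lgc A B

/-- The arc `{a, a+1, ..., a+m}` in `Z_n`. -/
def arcSet (n : ℕ) (a : ZMod n) (m : ℕ) : Set (ZMod n) :=
  {z | ∃ i ≤ m, z = a + (i : ZMod n)}

/-- The arc `P₁ = {n/6, ..., 5n/6}` of `Z_n` (identified with `{0,...,n-1}` via `val`). -/
def P1set (n : ℕ) : Set (ZMod n) := {z | n / 6 ≤ z.val ∧ z.val ≤ 5 * n / 6}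

/-- The subset `P_{1,n} = {(x,k) ∈ G_n : k ∈ P₁}`. -/
def lampP1 (n : ℕ) : Set (Lamp n) := {u | u.2 ∈ P1set n}

/-- The set `W_n ⊆ T_n × T_n`. -/
def Wset (n : ℕ) : Set (List Bool × List Bool) :=
  {p | p.1.length + p.2.length = n ∧ n / 6 ≤ p.1.length ∧ p.1.length ≤ 5 * n / 6}

open Classical in
/-- The map `φ_{1,n} : P_{1,n} → W_n`. -/
noncomputable def phi1 (n : ℕ) (u : Lamp n) : List Bool × List Bool :=
  ((List.range u.2.val).map fun j => if ((j : ℕ) : ZMod n) ∈ u.1 then true else false,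
   (List.range (n - u.2.val)).map fun i => if ((n - 1 - i : ℕ) : ZMod n) ∈ u.1 then true else false)

/-- "X admits an equivalent uniformly convex norm" (= superreflexivity, by Enflo). -/
def HasEquivUnifConvexNorm (X : Type*) [NormedAddCommGroup X] [NormedSpace ℝ X] : Prop :=
  ∃ N : X → ℝ,
    (∀ x, N x = 0 ↔ x = 0) ∧
    (∀ (c : ℝ) (x : X), N (c • x) = |c| * N x) ∧
    (∀ x y, N (x + y) ≤ N x + N y) ∧
    (∃ c₁ > (0 : ℝ), ∃ c₂ > (0 : ℝ), ∀ x, c₁ * ‖x‖ ≤ N x ∧ N x ≤ c₂ * ‖x‖) ∧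
    (∀ ε > (0 : ℝ), ∃ δ > (0 : ℝ), ∀ x y,
      N x ≤ 1 → N y ≤ 1 → ε ≤ N (x - y) → N (x + y) ≤ 2 - δ)

namespace LampProof

/-- Adjacency (oriented): move from `k` to `k+1`, possibly toggling lamp `k+1`. -/
def LEdge {n : ℕ} (u v : Lamp n) : Prop :=
  v.2 = u.2 + 1 ∧ ∀ z, z ≠ u.2 + 1 → (z ∈ u.1 ↔ z ∈ v.1)

def LReach {n : ℕ} (m : ℕ) (u v : Lamp n) : Prop :=
  ∃ w : List (Lamp n), w.length = m ∧
    (∀ s ∈ w, s ∈ ({lampT n, lampTA n} : Set (Lamp n)) ∨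
      ∃ g ∈ ({lampT n, lampTA n} : Set (Lamp n)), s = lampInv g) ∧ v = w.foldl lampMul u

lemma lampTA_eq (n : ℕ) : lampTA n = ({1}, 1) := by
  simp [lampTA, lampT, lampA, lampMul]

lemma LReach.refl {n : ℕ} (u : Lamp n) : LReach 0 u u := ⟨[], by simp⟩

lemma LReach.trans {n a b : ℕ} {u v w : Lamp n} (h : LReach a u v) (h' : LReach b v w) :
    LReach (a + b) u w := by
  obtain ⟨l, hl, hs, rfl⟩ := h
  obtain ⟨l', hl', hs', rfl⟩ := h'
  refine ⟨l ++ l', by simp [hl, hl'], ?_, by simp⟩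
  intro s hs1
  rcases List.mem_append.1 hs1 with h | h
  · exact hs s h
  · exact hs' s h

lemma lampMul_T {n : ℕ} (u : Lamp n) : lampMul u (lampT n) = (u.1, u.2 + 1) := by
  simp [lampMul, lampT]

lemma lampMul_TA {n : ℕ} (u : Lamp n) : lampMul u (lampTA n) = (u.1 ∆ {u.2 + 1}, u.2 + 1) := by
  simp [lampMul, lampTA_eq]

lemma lampMul_Ti {n : ℕ} (u : Lamp n) : lampMul u (lampInv (lampT n)) = (u.1, u.2 - 1) := by
  simp [lampMul, lampT, lampInv, sub_eq_add_neg]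

lemma lampMul_TAi {n : ℕ} (u : Lamp n) :
    lampMul u (lampInv (lampTA n)) = (u.1 ∆ {u.2}, u.2 - 1) := by
  simp [lampMul, lampTA_eq, lampInv, sub_eq_add_neg]

lemma LEdge.cases {n : ℕ} {u v : Lamp n} (h : LEdge u v) :
    v = (u.1, u.2 + 1) ∨ v = (u.1 ∆ {u.2 + 1}, u.2 + 1) := by
  obtain ⟨x, k⟩ := u
  obtain ⟨y, l⟩ := v
  obtain ⟨h1, h2⟩ := h
  simp only at h1 h2
  subst h1
  by_cases hk : (k + 1 ∈ x ↔ k + 1 ∈ y)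
  · left
    ext z <;> simp
    by_cases hz : z = k + 1
    · rw [hz]; exact hk.symm
    · exact (h2 z hz).symm
  · right
    ext z <;> simp [Set.mem_symmDiff]
    by_cases hz : z = k + 1
    · subst hz; simp; tauto
    · have := h2 z hz; simp [hz]; exact this.symm

lemma LEdge.reach {n : ℕ} {u v : Lamp n} (h : LEdge u v) : LReach 1 u v := by
  rcases h.cases with rfl | rfl
  · exact ⟨[lampT n], rfl, by simp, by simp [lampMul_T]⟩
  · exact ⟨[lampTA n], rfl, by simp, by simp [lampMul_TA]⟩

lemma LEdge.reach' {n : ℕ} {u v : Lamp n} (h : LEdge u v) : LReach 1 v u := by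
  rcases h.cases with rfl | rfl
  · exact ⟨[lampInv (lampT n)], rfl, by simp, by simp [lampMul_Ti]⟩
  · exact ⟨[lampInv (lampTA n)], rfl, by simp, by simp [lampMul_TAi]⟩

lemma step_edge {n : ℕ} (u s : Lamp n) (hs : s ∈ ({lampT n, lampTA n} : Set (Lamp n)) ∨
      ∃ g ∈ ({lampT n, lampTA n} : Set (Lamp n)), s = lampInv g) :
    LEdge u (lampMul u s) ∨ LEdge (lampMul u s) u := by
  simp only [Set.mem_insert_iff, Set.mem_singleton_iff, exists_eq_or_imp, exists_eq_left] at hs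
  rcases hs with (rfl | rfl) | rfl | rfl
  · left; rw [lampMul_T]; exact ⟨rfl, fun z _ => Iff.rfl⟩
  · left; rw [lampMul_TA]; exact ⟨rfl, fun z hz => by simp [Set.mem_symmDiff, hz]⟩
  · right; rw [lampMul_Ti]; exact ⟨by simp, fun z _ => Iff.rfl⟩
  · right; rw [lampMul_TAi]
    exact ⟨by simp, fun z hz => by
      have : z ≠ u.2 := by simpa using hz
      simp [Set.mem_symmDiff, this]⟩

lemma LReach.dist_le {n m : ℕ} {u v : Lamp n} (h : LReach m u v) : lampDist n u v ≤ m :=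
  Nat.sInf_le h

lemma LEdge.dist_le {n : ℕ} {u v : Lamp n} (h : LEdge u v) : lampDist n u v ≤ 1 :=
  h.reach.dist_le

lemma walk_cw {n : ℕ} (R : ℕ) : ∀ (k : ZMod n) (x y : Set (ZMod n)),
    (∀ z, (z ∈ x ↔ z ∈ y) ∨ ∃ i : ℕ, i < R ∧ z = k + 1 + i) → LReach (2 * R) (x, k) (y, k) := by
  induction R with
  | zero =>
    intro k x y h
    have : x = y := by ext z; simpa using h z
    subst this; exact LReach.refl _
  | succ R ih =>
    intro k x y h
    classical
    let x1 : Set (ZMod n) := {z | if z = k + 1 then z ∈ y else z ∈ x}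
    have e1 : LEdge (x, k) (x1, k + 1) := ⟨rfl, fun z hz => by
      simp only [x1, Set.mem_ofPred_eq] at *; simp [hz]⟩
    have e2 : LEdge (y, k) (y, k + 1) := ⟨rfl, fun z hz => Iff.rfl⟩
    have := ih (k + 1) x1 y (by
      intro z
      by_cases hz : z = k + 1
      · left; simp [x1, hz]
      · simp only [x1, Set.mem_ofPred_eq, hz, if_false]
        rcases h z with h | ⟨i, hi, rfl⟩
        · exact Or.inl h
        · right
          rcases i with _ | i
          · simp at hz
          · exact ⟨i, by omega, by push_cast; ring⟩)
    have := (e1.reach.trans this).trans e2.reach'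
    convert this using 1; ring

lemma walk_ccw {n : ℕ} (R : ℕ) : ∀ (k : ZMod n) (x y : Set (ZMod n)),
    (∀ z, (z ∈ x ↔ z ∈ y) ∨ ∃ i : ℕ, i < R ∧ z = k - i) → LReach (2 * R) (x, k) (y, k) := by
  induction R with
  | zero =>
    intro k x y h
    have : x = y := by ext z; simpa using h z
    subst this; exact LReach.refl _
  | succ R ih =>
    intro k x y h
    classical
    let x1 : Set (ZMod n) := {z | if z = k then z ∈ y else z ∈ x}
    have e1 : LEdge (x1, k - 1) (x, k) := ⟨by simp, fun z hz => by
      have : z ≠ k := by simpa using hz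
      simp only [x1, Set.mem_ofPred_eq] at *; simp [this]⟩
    have e2 : LEdge (y, k - 1) (y, k) := ⟨by simp, fun z hz => Iff.rfl⟩
    have := ih (k - 1) x1 y (by
      intro z
      by_cases hz : z = k
      · left; simp [x1, hz]
      · simp only [x1, Set.mem_ofPred_eq, hz, if_false]
        rcases h z with h | ⟨i, hi, rfl⟩
        · exact Or.inl h
        · right
          rcases i with _ | i
          · simp at hz
          · exact ⟨i, by omega, by push_cast; ring⟩)
    have := (e1.reach'.trans this).trans e2.reach
    convert this using 1; ring

lemma move_cw {n : ℕ} (x : Set (ZMod n)) (k : ZMod n) (d : ℕ) : LReach d (x, k) (x, k + d) := by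
  induction d with
  | zero => simpa using LReach.refl _
  | succ d ih =>
    refine ih.trans (LEdge.reach ⟨by push_cast; ring, fun z _ => Iff.rfl⟩)

lemma move_ccw {n : ℕ} (x : Set (ZMod n)) (k : ZMod n) (d : ℕ) : LReach d (x, k) (x, k - d) := by
  induction d with
  | zero => simpa using LReach.refl _
  | succ d ih =>
    refine ih.trans (LEdge.reach' ⟨by push_cast; ring, fun z _ => Iff.rfl⟩)

lemma reach_bound {n : ℕ} (R d : ℕ) (k l : ZMod n) (x y : Set (ZMod n))
    (h : ∀ z, (z ∈ x ↔ z ∈ y) ∨ (∃ i : ℕ, i < R ∧ z = k + 1 + i) ∨ ∃ i : ℕ, i < R ∧ z = k - i)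
    (hd : l = k + d ∨ l = k - d) : LReach (4 * R + d) (x, k) (y, l) := by
  classical
  let x1 : Set (ZMod n) := {z | if ∃ i : ℕ, i < R ∧ z = k + 1 + i then z ∈ y else z ∈ x}
  have h1 : LReach (2 * R) (x, k) (x1, k) := walk_cw R k x x1 (by
    intro z
    by_cases hz : ∃ i : ℕ, i < R ∧ z = k + 1 + i
    · exact Or.inr hz
    · left; simp only [x1, Set.mem_ofPred_eq, hz, if_false])
  have h2 : LReach (2 * R) (x1, k) (y, k) := walk_ccw R k x1 y (by
    intro z
    by_cases hz : ∃ i : ℕ, i < R ∧ z = k + 1 + i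
    · left; simp only [x1, Set.mem_ofPred_eq, hz, if_true]
    · simp only [x1, Set.mem_ofPred_eq, hz, if_false]
      rcases h z with h | h | h
      · exact Or.inl h
      · exact absurd h hz
      · exact Or.inr h)
  have h3 : LReach d (y, k) (y, l) := by
    rcases hd with rfl | rfl
    · exact move_cw _ _ _
    · exact move_ccw _ _ _
  have := (h1.trans h2).trans h3
  convert this using 1; ring

lemma reach_exists {n : ℕ} [NeZero n] (u v : Lamp n) : ∃ m, LReach m u v := by
  refine ⟨4 * n + (v.2 - u.2).val, reach_bound n _ u.2 v.2 u.1 v.1 ?_ ?_⟩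
  · intro z
    right; left
    exact ⟨(z - (u.2 + 1)).val, ZMod.val_lt _, by simp⟩
  · left; simp

lemma reach_dist {n : ℕ} [NeZero n] (u v : Lamp n) : LReach (lampDist n u v) u v :=
  Nat.sInf_mem (s := {m | LReach m u v}) (reach_exists u v)

lemma reach_lip {n : ℕ} {E : Type*} [PseudoMetricSpace E] (Φ : Lamp n → E) (C : ℝ)
    (h : ∀ u v, LEdge u v → dist (Φ u) (Φ v) ≤ C) {m : ℕ} {u v : Lamp n} (hr : LReach m u v) :
    dist (Φ u) (Φ v) ≤ C * m := by
  obtain ⟨w, hl, hs, rfl⟩ := hr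
  subst hl
  induction w generalizing u with
  | nil => simp
  | cons s w ih =>
    have h1 : dist (Φ u) (Φ (lampMul u s)) ≤ C := by
      rcases step_edge u s (hs s (by simp)) with e | e
      · exact h _ _ e
      · rw [dist_comm]; exact h _ _ e
    have h2 := ih (u := lampMul u s) (fun t ht => hs t (by simp [ht]))
    have h3 := dist_triangle (Φ u) (Φ (lampMul u s)) (Φ (w.foldl lampMul (lampMul u s)))
    simp only [List.foldl_cons, List.length_cons]
    push_cast
    linarith

lemma lip_of_edge {n : ℕ} [NeZero n] {E : Type*} [PseudoMetricSpace E] (Φ : Lamp n → E) (C : ℝ)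
    (h : ∀ u v, LEdge u v → dist (Φ u) (Φ v) ≤ C) (u v : Lamp n) :
    dist (Φ u) (Φ v) ≤ C * lampDist n u v :=
  reach_lip Φ C h (reach_dist u v)

end LampProof

namespace LampProof

/-- cyclic distance -/
def dep (n : ℕ) (p k : ZMod n) : ℕ := min (k - p).val (n - (k - p).val)

lemma val_succ_cases {n : ℕ} (hn : 2 ≤ n) (a : ZMod n) :
    (a.val + 1 < n ∧ (a + 1).val = a.val + 1) ∨ (a.val + 1 = n ∧ (a + 1).val = 0) := by
  have : NeZero n := ⟨by omega⟩
  have : Fact (1 < n) := ⟨by omega⟩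
  have h := ZMod.val_add a 1
  rw [ZMod.val_one] at h
  have ha := ZMod.val_lt a
  rcases Nat.lt_or_ge (a.val + 1) n with h1 | h1
  · left; exact ⟨h1, by rw [h, Nat.mod_eq_of_lt h1]⟩
  · right
    have : a.val + 1 = n := by omega
    exact ⟨this, by rw [h, this, Nat.mod_self]⟩

lemma dep_step {n : ℕ} (hn : 2 ≤ n) (p k : ZMod n) :
    dep n p (k + 1) ≤ dep n p k + 1 ∧ dep n p k ≤ dep n p (k + 1) + 1 := by
  unfold dep
  have : k + 1 - p = (k - p) + 1 := by ring
  rw [this]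
  rcases val_succ_cases hn (k - p) with ⟨h1, h2⟩ | ⟨h1, h2⟩ <;> rw [h2] <;> omega

lemma dist_lower {n : ℕ} (hn : 2 ≤ n) (m : ℕ) (hm : 2 * m ≤ n) (k : ZMod n)
    (x y : Set (ZMod n)) (hx : k + 1 ∈ x) (hy : k + 1 ∉ y) :
    m ≤ lampDist n (x, k + m) (y, k + m) := by
  classical
  have : NeZero n := ⟨by omega⟩
  let Φ : Lamp n → ℝ := fun u => if k + 1 ∈ u.1 then (dep n k u.2 : ℝ) else 0
  have h := lip_of_edge Φ 1 (by
    rintro ⟨z, a⟩ ⟨z', b⟩ ⟨h1, h2⟩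
    simp only at h1 h2
    subst h1
    simp only [Φ]
    have hs := dep_step hn k a
    have hs1 : (dep n k (a + 1) : ℝ) ≤ dep n k a + 1 := by exact_mod_cast hs.1
    have hs2 : (dep n k a : ℝ) ≤ dep n k (a + 1) + 1 := by exact_mod_cast hs.2
    have p1 : (0 : ℝ) ≤ dep n k (a + 1) := by positivity
    have p2 : (0 : ℝ) ≤ dep n k a := by positivity
    by_cases ha : a = k
    · subst ha
      have h0 : (dep n a a : ℝ) = 0 := by simp [dep]
      rw [Real.dist_eq, abs_le]
      split_ifs <;> constructor <;> linarith
    · have := h2 (k + 1) (by simpa using fun h => ha h.symm)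
      rw [this, Real.dist_eq, abs_le]
      split_ifs <;> constructor <;> linarith) (x, k + m) (y, k + m)
  simp only [Φ, hx, hy, if_true, if_false] at h
  have hd : dep n k (k + m) = m := by
    unfold dep
    rw [add_sub_cancel_left, ZMod.val_natCast_of_lt (by omega)]
    omega
  rw [hd] at h
  simp at h
  exact_mod_cast h

theorem not_unifConvex_of_embed (X : Type*) [NormedAddCommGroup X] [NormedSpace ℝ X]
    (D : ℝ) (hD : 1 ≤ D)
    (H : ∀ n : ℕ, 2 ≤ n →
        ∃ (f : Lamp n → X) (r : ℝ), 0 < r ∧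
          ∀ u v : Lamp n,
            r * (lampDist n u v : ℝ) ≤ ‖f u - f v‖ ∧
            ‖f u - f v‖ ≤ D * r * (lampDist n u v : ℝ)) :
    ¬ HasEquivUnifConvexNorm X := by
  rintro ⟨N, N0, Nsmul, Nadd, ⟨c₁, hc₁, c₂, hc₂, hN⟩, hUC⟩
  have hDpos : 0 < D := by linarith
  set ε : ℝ := c₁ / (2 * c₂ * D) with hε
  have hεpos : 0 < ε := by positivity
  obtain ⟨δ', hδ', hδuc'⟩ := hUC ε hεpos
  -- make δ ≤ 1
  set δ := min δ' 1 with hδdef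
  have hδ : 0 < δ := lt_min hδ' one_pos
  have hδ1 : δ ≤ 1 := min_le_right _ _
  have hδuc : ∀ x y, N x ≤ 1 → N y ≤ 1 → ε ≤ N (x - y) → N (x + y) ≤ 2 - δ := by
    intro x y hx hy hxy
    have := hδuc' x y hx hy hxy
    have := min_le_left δ' 1
    linarith
  have Nneg : ∀ x, N (-x) = N x := by
    intro x
    have := Nsmul (-1) x
    simpa using this
  have Nsub : ∀ x y, N (x - y) = N (y - x) := by
    intro x y; rw [← Nneg, neg_sub]
  -- choose J
  obtain ⟨J, hJ⟩ := exists_pow_lt_of_lt_one (show 0 < c₁ / (2 * c₂ * D) by positivity)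
    (show 1 - δ / 2 < 1 by linarith)
  set n := 2 * 2 ^ J with hn
  have hJ1 : 1 ≤ 2 ^ J := Nat.one_le_two_pow
  have hn2 : 2 ≤ n := by omega
  obtain ⟨f, r, hr, hf⟩ := H n hn2
  set L0 := c₂ * D * r with hL0
  have hL0pos : 0 < L0 := by positivity
  have lower : ∀ u v, c₁ * r * lampDist n u v ≤ N (f u - f v) := by
    intro u v
    calc c₁ * r * lampDist n u v = c₁ * (r * lampDist n u v) := by ring
      _ ≤ c₁ * ‖f u - f v‖ := by gcongr; exact (hf u v).1
      _ ≤ _ := (hN _).1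
  have upper : ∀ u v, LEdge u v → N (f v - f u) ≤ L0 := by
    intro u v huv
    rw [Nsub]
    calc N (f u - f v) ≤ c₂ * ‖f u - f v‖ := (hN _).2
      _ ≤ c₂ * (D * r * lampDist n u v) := by gcongr; exact (hf u v).2
      _ ≤ c₂ * (D * r * 1) := by
        gcongr; exact_mod_cast huv.dist_le
      _ = L0 := by rw [hL0]; ring
  have key : ∀ j, j ≤ J → ∀ (x : Set (ZMod n)) (k : ZMod n) (b : Prop),
      ∃ x' : Set (ZMod n), (k + 1 ∈ x' ↔ b) ∧
        (∀ i : ℕ, 2 ^ j ≤ i → i < n → (k + 1 + i ∈ x' ↔ k + 1 + i ∈ x)) ∧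
        N (f (x', k + (2 ^ j : ℕ)) - f (x, k)) ≤ L0 * (2 - δ) ^ j := by
    intro j
    induction j with
    | zero =>
      intro _ x k b
      classical
      refine ⟨{z | if z = k + 1 then b else z ∈ x}, by simp, ?_, ?_⟩
      · intro i hi hin
        have : (i : ZMod n) ≠ 0 := by
          intro h0
          rw [ZMod.natCast_eq_zero_iff] at h0
          have := Nat.le_of_dvd (by omega) h0
          omega
        simp [this]
      · rw [pow_zero, pow_zero, mul_one]
        apply upper
        refine ⟨by simp, fun z hz => ?_⟩
        simp only at hz
        simp [hz]
    | succ j ih =>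
      intro hj x k b
      have hpow : 2 * 2 ^ j ≤ 2 ^ J := by
        calc 2 * 2 ^ j = 2 ^ (j + 1) := by ring
          _ ≤ 2 ^ J := Nat.pow_le_pow_right (by norm_num) hj
      have hj1 : 1 ≤ 2 ^ j := Nat.one_le_two_pow
      obtain ⟨x1, h1b, h1a, h1N⟩ := ih (by omega) x k b
      obtain ⟨y, hyb, hya, hyN⟩ := ih (by omega) x1 (k + (2 ^ j : ℕ)) True
      obtain ⟨z, hzb, hza, hzN⟩ := ih (by omega) x1 (k + (2 ^ j : ℕ)) False
      simp only [iff_true, iff_false] at hyb hzb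
      set L := L0 * (2 - δ) ^ j with hL
      have hLpos : 0 < L := by
        have : 0 < 2 - δ := by linarith
        positivity
      have hLle : L ≤ L0 * 2 ^ j := by
        rw [hL]; gcongr <;> linarith
      -- separation
      have hsep : 2 * ε * L ≤ N (f (y, k + (2 ^ j : ℕ) + (2 ^ j : ℕ))
          - f (z, k + (2 ^ j : ℕ) + (2 ^ j : ℕ))) := by
        have h1 := dist_lower hn2 (2 ^ j) (by omega) (k + (2 ^ j : ℕ)) y z hyb hzb
        refine le_trans ?_ (lower _ _)
        have h2 : ((2 ^ j : ℕ) : ℝ) ≤ (lampDist n (y, k + (2 ^ j : ℕ) + (2 ^ j : ℕ))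
          (z, k + (2 ^ j : ℕ) + (2 ^ j : ℕ)) : ℝ) := by exact_mod_cast h1
        calc 2 * ε * L ≤ 2 * ε * (L0 * 2 ^ j) := by gcongr
          _ = c₁ * r * ((2 ^ j : ℕ) : ℝ) := by
            rw [hε, hL0]; push_cast; field_simp
          _ ≤ _ := by gcongr
      have hcheck : ∀ w : Set (ZMod n), 
          (∀ i : ℕ, 2 ^ j ≤ i → i < n → (k + (2 ^ j : ℕ) + 1 + i ∈ w ↔ k + (2 ^ j : ℕ) + 1 + i ∈ x1)) →
          (k + 1 ∈ w ↔ b) ∧ 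
          (∀ i : ℕ, 2 ^ (j+1) ≤ i → i < n → (k + 1 + i ∈ w ↔ k + 1 + i ∈ x)) := by
        intro w hw
        constructor
        · have := hw (n - 2 ^ j) (by omega) (by omega)
          have e : k + (2 ^ j : ℕ) + 1 + ((n - 2 ^ j : ℕ) : ZMod n) = k + 1 := by
            rw [Nat.cast_sub (by omega)]; simp; ring
          rw [e] at this
          rw [this, h1b]
        · intro i hi hin
          have hi' : 2 * 2 ^ j ≤ i := by rw [pow_succ] at hi; omega
          have := hw (i - 2 ^ j) (by omega) (by omega)
          have e : k + (2 ^ j : ℕ) + 1 + ((i - 2 ^ j : ℕ) : ZMod n) = k + 1 + i := by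
            rw [Nat.cast_sub (by omega)]; ring
          rw [e] at this
          rw [this, h1a i (by omega) hin]
      have e2 : k + ((2 ^ (j + 1) : ℕ) : ZMod n) = k + (2 ^ j : ℕ) + (2 ^ j : ℕ) := by
        push_cast; ring
      -- fork
      have scale : ∀ v, N v ≤ L → N (L⁻¹ • v) ≤ 1 := by
        intro v hv
        rw [Nsmul, abs_of_pos (by positivity), inv_mul_le_iff₀ hLpos]; linarith
      have fork : ∀ w, N (f (w, k + (2 ^ j : ℕ) + (2 ^ j : ℕ)) - f (x1, k + (2 ^ j : ℕ))) ≤ L →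
          ε * L ≤ N ((f (w, k + (2 ^ j : ℕ) + (2 ^ j : ℕ)) - f (x1, k + (2 ^ j : ℕ))) -
            (f (x1, k + (2 ^ j : ℕ)) - f (x, k))) →
          N (f (w, k + (2 ^ j : ℕ) + (2 ^ j : ℕ)) - f (x, k)) ≤ L0 * (2 - δ) ^ (j + 1) := by
        intro w hw1 hw2
        have := hδuc _ _ (scale _ hw1) (scale _ h1N) (by
          rw [← smul_sub, Nsmul, abs_of_pos (by positivity), le_inv_mul_iff₀ hLpos]; linarith)
        rw [← smul_add, Nsmul, abs_of_pos (by positivity), inv_mul_le_iff₀ hLpos,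
          sub_add_sub_cancel] at this
        calc _ ≤ _ := this
          _ = _ := by rw [hL]; ring
      by_cases hc : ε * L ≤ N ((f (y, k + (2 ^ j : ℕ) + (2 ^ j : ℕ)) - f (x1, k + (2 ^ j : ℕ))) -
            (f (x1, k + (2 ^ j : ℕ)) - f (x, k)))
      · refine ⟨y, (hcheck y hya).1, (hcheck y hya).2, ?_⟩
        rw [e2]; exact fork y hyN hc
      · refine ⟨z, (hcheck z hza).1, (hcheck z hza).2, ?_⟩
        rw [e2]; refine fork z hzN ?_
        push Not at hc
        have h3 := Nadd ((f (y, k + (2 ^ j : ℕ) + (2 ^ j : ℕ)) - f (x1, k + (2 ^ j : ℕ))) -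
            (f (x1, k + (2 ^ j : ℕ)) - f (x, k)))
            (-((f (z, k + (2 ^ j : ℕ) + (2 ^ j : ℕ)) - f (x1, k + (2 ^ j : ℕ))) -
            (f (x1, k + (2 ^ j : ℕ)) - f (x, k))))
        rw [Nneg] at h3
        have e3 : ∀ a b c d : X, (a - b - (b - d)) + -(c - b - (b - d)) = a - c := by
          intros; abel
        rw [e3] at h3
        linarith
  obtain ⟨y, hyb, -, hyN⟩ := key J le_rfl ∅ 0 True
  obtain ⟨z, hzb, -, hzN⟩ := key J le_rfl ∅ 0 False
  simp only [iff_true, iff_false] at hyb hzb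
  have h1 := dist_lower hn2 (2 ^ J) (by omega) 0 y z hyb hzb
  have h2 := lower (y, 0 + (2 ^ J : ℕ)) (z, 0 + (2 ^ J : ℕ))
  have h2' : c₁ * r * 2 ^ J ≤ c₁ * r * (lampDist n (y, 0 + (2 ^ J : ℕ)) (z, 0 + (2 ^ J : ℕ)) : ℝ) := by
    gcongr; exact_mod_cast h1
  have h3 := Nadd (f (y, 0 + (2 ^ J : ℕ)) - f (∅, 0)) (-(f (z, 0 + (2 ^ J : ℕ)) - f (∅, 0)))
  rw [Nneg] at h3
  have e3 : ∀ a c d : X, (a - d) + -(c - d) = a - c := by intros; abel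
  rw [e3] at h3
  have h4 : c₁ * r * 2 ^ J ≤ 2 * (L0 * (2 - δ) ^ J) := by linarith
  have h5 : (2 - δ) ^ J = 2 ^ J * (1 - δ / 2) ^ J := by
    rw [← mul_pow]; congr 1; ring
  rw [h5, hL0] at h4
  rw [lt_div_iff₀ (by positivity)] at hJ
  have : (1 - δ / 2) ^ J * (2 * c₂ * D) * (r * 2 ^ J) < c₁ * (r * 2 ^ J) := by gcongr
  linarith

end LampProof

namespace LampProof
open Classical in
noncomputable def inkey (n : ℕ) (X : ℕ → Prop) (L : ℕ) : ℕ :=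
  (∑ i ∈ Finset.range L, if X i then 2 ^ (n - i) else 0) + 2 ^ (n - L)

def lampBits {n : ℕ} (p : ZMod n) (x : Set (ZMod n)) (i : ℕ) : Prop := p + 1 + (i : ZMod n) ∈ x

noncomputable def blockSum {n : ℕ} {E : Type*} [AddCommMonoid E] (ψ : ℕ → E) (p : ZMod n)
    (off : ℕ) (u : Lamp n) : E :=
  ∑ L ∈ Finset.range (dep n p u.2), ψ (off + inkey n (lampBits p u.1) (L + 1))

def lampRefl {n : ℕ} (u : Lamp n) : Lamp n := ({z | 1 - z ∈ u.1}, -u.2)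

lemma lampRefl_edge {n : ℕ} {u v : Lamp n} (h : LEdge u v) : LEdge (lampRefl v) (lampRefl u) := by
  obtain ⟨h1, h2⟩ := h
  refine ⟨by simp [lampRefl, h1], fun z hz => ?_⟩
  simp only [lampRefl, h1] at hz
  have := h2 (1 - z) (by
    intro h; apply hz
    have : z = 1 - (u.2 + 1) := by rw [← h]; ring
    rw [this]; ring)
  simpa [lampRefl] using this.symm

lemma dep_le {n : ℕ} (p k : ZMod n) : 2 * dep n p k ≤ n := by
  unfold dep; omega

open Classical in
lemma inkey_tail (n : ℕ) (X : ℕ → Prop) (q d : ℕ) (h : q + d ≤ n) :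
    (∑ i ∈ Finset.Ico q (q + d), if X i then 2 ^ (n - i) else 0) + 2 * 2 ^ (n - (q + d))
      ≤ 2 * 2 ^ (n - q) := by
  induction d with
  | zero => simp
  | succ d ih =>
    have := ih (by omega)
    rw [← add_assoc, Finset.sum_Ico_succ_top (by omega)]
    have e : 2 ^ (n - (q + d)) = 2 * 2 ^ (n - (q + d + 1)) := by
      rw [← pow_succ']; congr 1; omega
    have e' : (if X (q + d) then 2 ^ (n - (q + d)) else 0) ≤ 2 ^ (n - (q + d)) := by
      split_ifs <;> simp
    omega

lemma inkey_lt (n : ℕ) (X : ℕ → Prop) (L : ℕ) (h : L ≤ n) : inkey n X L < 2 ^ (n + 1) := by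
  have := inkey_tail n X 0 L (by omega)
  simp only [zero_add, Nat.Ico_zero_eq_range, Nat.sub_zero] at this
  unfold inkey
  have h2 : 0 < 2 ^ (n - L) := by positivity
  rw [pow_succ]
  omega

open Classical in
noncomputable def keyCut (n : ℕ) (X : ℕ → Prop) (q : ℕ) : ℕ :=
  (∑ i ∈ Finset.range q, if X i then 2 ^ (n - i) else 0) + 2 ^ (n - q)

lemma inkey_lt_cut (n : ℕ) (X : ℕ → Prop) (q L : ℕ) (hq : ¬ X q) (hL : q < L) (h : L ≤ n) :
    inkey n X L < keyCut n X q := by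
  have := inkey_tail n X (q + 1) (L - (q + 1)) (by omega)
  rw [show q + 1 + (L - (q + 1)) = L by omega] at this
  have h2 : 0 < 2 ^ (n - L) := by positivity
  unfold inkey keyCut
  rw [← Finset.sum_range_add_sum_Ico _ (show q + 1 ≤ L by omega), Finset.sum_range_succ]
  simp only [hq, if_false]
  have e : 2 ^ (n - q) = 2 * 2 ^ (n - (q + 1)) := by
    rw [← pow_succ']; congr 1; omega
  omega

lemma cut_le_inkey (n : ℕ) (X : ℕ → Prop) (q L : ℕ) (hq : X q) (hL : q < L) :
    keyCut n X q ≤ inkey n X L := by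
  unfold inkey keyCut
  rw [← Finset.sum_range_add_sum_Ico _ (show q + 1 ≤ L by omega), Finset.sum_range_succ]
  simp only [hq, if_true]
  rw [add_assoc]
  exact Nat.le_add_right _ _

open Classical in
lemma keyCut_congr (n : ℕ) (X Y : ℕ → Prop) (L : ℕ) (h : ∀ i < L, (X i ↔ Y i)) :
    keyCut n X L = keyCut n Y L := by
  unfold keyCut
  congr 1
  apply Finset.sum_congr rfl
  intro i hi
  exact if_congr (h i (Finset.mem_range.1 hi)) rfl rfl

open Classical in
/-- number of nodes on the branch of `X` of depth `m` with key at least `Q` -/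
noncomputable def cnt (n : ℕ) (X : ℕ → Prop) (m Q : ℕ) : ℕ :=
  ∑ L ∈ Finset.range m, if Q ≤ inkey n X (L + 1) then 1 else 0

lemma cnt_zero (n : ℕ) (X : ℕ → Prop) (m : ℕ) : cnt n X m 0 = m := by simp [cnt]

lemma sum_range_close {E : Type*} [NormedAddCommGroup E] (a b : ℕ → E) (m m' : ℕ)
    (h1 : m ≤ m' + 1) (h2 : m' ≤ m + 1) (hab : ∀ L, L < m → L < m' → a L = b L) (C : ℝ)
    (hC : 0 ≤ C) (ha : ∀ L, ‖a L‖ ≤ C) (hb : ∀ L, ‖b L‖ ≤ C) :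
    ‖∑ L ∈ Finset.range m, a L - ∑ L ∈ Finset.range m', b L‖ ≤ C := by
  rcases (by omega : m = m' ∨ m = m' + 1 ∨ m' = m + 1) with rfl | rfl | rfl
  · rw [Finset.sum_congr rfl (fun L hL => hab L (Finset.mem_range.1 hL) (Finset.mem_range.1 hL))]
    simpa
  · rw [Finset.sum_range_succ, Finset.sum_congr rfl (fun L hL => hab L
      (by have := Finset.mem_range.1 hL; omega) (Finset.mem_range.1 hL))]
    simpa using ha _
  · rw [Finset.sum_range_succ, Finset.sum_congr rfl (fun L hL => hab L
      (Finset.mem_range.1 hL) (by have := Finset.mem_range.1 hL; omega))]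
    simpa using hb _

open Classical in
lemma inkey_congr (n : ℕ) (X Y : ℕ → Prop) (L : ℕ) (h : ∀ i < L, (X i ↔ Y i)) :
    inkey n X L = inkey n Y L := by
  unfold inkey
  congr 1
  apply Finset.sum_congr rfl
  intro i hi
  exact if_congr (h i (Finset.mem_range.1 hi)) rfl rfl

lemma cnt_tail (n : ℕ) (X Y : ℕ → Prop) (q mX mY : ℕ) (h : ∀ i < q, (X i ↔ Y i))
    (hX : ¬ X q) (hY : Y q) (hqY : q ≤ mY) (hmX : mX ≤ n) :
    cnt n X mX (keyCut n X q) + (mY - q) ≤ cnt n Y mY (keyCut n X q) := by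
  classical
  have h1 : cnt n X mX (keyCut n X q) ≤
      ∑ L ∈ Finset.range q, if keyCut n X q ≤ inkey n X (L + 1) then 1 else 0 := by
    unfold cnt
    apply Finset.sum_le_sum_of_ne_zero
    intro L hL hne
    have hL' := Finset.mem_range.1 hL
    rw [Finset.mem_range]
    by_contra hcon
    apply hne
    have := inkey_lt_cut n X q (L + 1) hX (by omega) (by omega)
    rw [if_neg (by omega)]
  have h2 : cnt n Y mY (keyCut n X q) =
      (∑ L ∈ Finset.range q, if keyCut n X q ≤ inkey n Y (L + 1) then 1 else 0) + (mY - q) := by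
    unfold cnt
    rw [← Finset.sum_range_add_sum_Ico _ hqY]
    congr 1
    rw [Finset.sum_congr rfl (g := fun _ => 1)]
    · simp
    · intro L hL
      have hL' := Finset.mem_Ico.1 hL
      rw [if_pos]
      rw [keyCut_congr n X Y q h]
      exact cut_le_inkey n Y q (L + 1) hY (by omega)
  have h3 : (∑ L ∈ Finset.range q, if keyCut n X q ≤ inkey n X (L + 1) then 1 else 0) =
      (∑ L ∈ Finset.range q, if keyCut n X q ≤ inkey n Y (L + 1) then 1 else 0) := by
    apply Finset.sum_congr rfl
    intro L hL
    have hL' := Finset.mem_range.1 hL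
    rw [inkey_congr n X Y (L + 1) (fun i hi => h i (by omega))]
  omega

lemma cnt_detect (n : ℕ) (X Y : ℕ → Prop) (g mX mY : ℕ) (hg : ¬ (X g ↔ Y g))
    (hgX : g < mX) (hmX : mX ≤ n) (hmY : mY ≤ n) :
    ∃ Q, (mX : ℤ) - g ≤ 2 * |(cnt n X mX Q : ℤ) - cnt n Y mY Q| := by
  classical
  have hex : ∃ q, ¬ (X q ↔ Y q) := ⟨g, hg⟩
  let q := Nat.find hex
  have hq : ¬ (X q ↔ Y q) := Nat.find_spec hex
  have hqg : q ≤ g := Nat.find_min' hex hg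
  have hlt : ∀ i < q, (X i ↔ Y i) := fun i hi => not_not.1 (Nat.find_min hex hi)
  by_cases htot : (mX : ℤ) - g ≤ 2 * |(mX : ℤ) - mY|
  · exact ⟨0, by rwa [cnt_zero, cnt_zero]⟩
  · have hmYq : q ≤ mY := by
      by_contra hc
      apply htot
      rw [abs_of_nonneg (by omega)]; omega
    have hab := le_abs_self ((mX : ℤ) - mY)
    by_cases hXq : X q
    · have hYq : ¬ Y q := by tauto
      have := cnt_tail n Y X q mY mX (fun i hi => (hlt i hi).symm) hYq hXq (by omega) hmY
      refine ⟨keyCut n Y q, ?_⟩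
      have h2 := le_abs_self ((cnt n X mX (keyCut n Y q) : ℤ) - cnt n Y mY (keyCut n Y q))
      omega
    · have hYq : Y q := by tauto
      have := cnt_tail n X Y q mX mY hlt hXq hYq hmYq hmX
      refine ⟨keyCut n X q, ?_⟩
      have h2 := neg_abs_le ((cnt n X mX (keyCut n X q) : ℤ) - cnt n Y mY (keyCut n X q))
      omega

/-- the eight base points -/
def baseP (n : ℕ) (j : ℕ) : ZMod n := ((j * ((n + 7) / 8) : ℕ) : ZMod n)

lemma exists_base {n : ℕ} (hn : 2 ≤ n) (z : ZMod n) :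
    ∃ j < 8, 8 * (z - baseP n j).val ≤ n - 1 := by
  have : NeZero n := ⟨by omega⟩
  have hz := ZMod.val_lt z
  set h := (n + 7) / 8 with hh
  have hpos : 0 < h := by omega
  refine ⟨z.val / h, ?_, ?_⟩
  · rw [Nat.div_lt_iff_lt_mul hpos]; omega
  · have hm := Nat.mod_lt z.val hpos
    have e : z - baseP n (z.val / h) = ((z.val % h : ℕ) : ZMod n) := by
      have h1 : (z.val / h) * h + z.val % h = z.val := by
        rw [mul_comm]; exact Nat.div_add_mod _ _
      have h2 : ((((z.val / h) * h + z.val % h : ℕ)) : ZMod n) = z := by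
        rw [h1]; simp
      rw [Nat.cast_add] at h2
      unfold baseP
      rw [← hh]
      rw [sub_eq_iff_eq_add, add_comm]
      exact h2.symm
    rw [e, ZMod.val_natCast_of_lt (by omega)]
    omega

noncomputable def lcnt {n : ℕ} (p : ZMod n) (Q : ℕ) (u : Lamp n) : ℕ :=
  cnt n (lampBits p u.1) (dep n p u.2) Q

lemma detect_edge {n : ℕ} (hn : 2 ≤ n) (k l e : ZMod n) (x y : Set (ZMod n))
    (he : ¬ (e ∈ x ↔ e ∈ y)) (hβ : 2 * (k - e).val ≤ n - 1) :
    ∃ j < 8, ∃ Q, ((k - e).val : ℤ) + 1 ≤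
      12 * |(lcnt (baseP n j) Q (x, k) : ℤ) - lcnt (baseP n j) Q (y, l)| := by
  have : NeZero n := ⟨by omega⟩
  obtain ⟨j, hj, hg⟩ := exists_base hn (e - 1)
  refine ⟨j, hj, ?_⟩
  set p := baseP n j
  set g := (e - 1 - p).val with hgdef
  set β := (k - e).val with hβdef
  have hgc : (g : ZMod n) = e - 1 - p := by simp [hgdef]
  have hβc : (β : ZMod n) = k - e := by simp [hβdef]
  have hkk : (k - p).val = β + 1 + g := by
    have : k - p = ((β + 1 + g : ℕ) : ZMod n) := by
      push_cast; rw [hgc, hβc]; ring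
    rw [this, ZMod.val_natCast_of_lt (by omega)]
  have hdep : dep n p k = min (β + 1 + g) (n - (β + 1 + g)) := by unfold dep; rw [hkk]
  have hbit : ∀ w : Set (ZMod n), lampBits p w g ↔ e ∈ w := by
    intro w; unfold lampBits; rw [hgc]
    rw [show p + 1 + (e - 1 - p) = e by ring]
  have hd1 := dep_le p k
  have hd2 := dep_le p l
  obtain ⟨Q, hQ⟩ := cnt_detect n (lampBits p x) (lampBits p y) g (dep n p k) (dep n p l)
    (by rw [hbit, hbit]; exact he) (by omega) (by omega) (by omega)
  refine ⟨Q, ?_⟩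
  unfold lcnt
  simp only
  omega

lemma detect_pos {n : ℕ} (hn : 2 ≤ n) (k l : ZMod n) (x y : Set (ZMod n))
    (hd : 2 * (k - l).val ≤ n) :
    ∃ j < 8, ((k - l).val : ℤ)  ≤
      2 * |(lcnt (baseP n j) 0 (x, k) : ℤ) - lcnt (baseP n j) 0 (y, l)| := by
  have : NeZero n := ⟨by omega⟩
  obtain ⟨j, hj, hg⟩ := exists_base hn l
  refine ⟨j, hj, ?_⟩
  set p := baseP n j
  set g := (l - p).val with hgdef
  set d := (k - l).val with hddef
  have hgc : (g : ZMod n) = l - p := by simp [hgdef]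
  have hdc : (d : ZMod n) = k - l := by simp [hddef]
  have hkk : (k - p).val = d + g := by
    have : k - p = ((d + g : ℕ) : ZMod n) := by
      push_cast; rw [hgc, hdc]; ring
    rw [this, ZMod.val_natCast_of_lt (by omega)]
  unfold lcnt
  rw [cnt_zero, cnt_zero]
  have h1 : dep n p k = min (d + g) (n - (d + g)) := by unfold dep; rw [hkk]
  have h2 : dep n p l = min g (n - g) := rfl
  simp only [h1, h2]
  refine le_trans ?_ (mul_le_mul_of_nonneg_left (le_abs_self _) (by norm_num))
  omega

lemma detect {n : ℕ} (hn : 2 ≤ n) (u v : Lamp n) :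
    ∃ j < 8, ∃ Q, (lampDist n u v : ℤ) ≤ 50 * |(lcnt (baseP n j) Q u : ℤ) - lcnt (baseP n j) Q v| ∨
      (lampDist n u v : ℤ) ≤ 50 * |(lcnt (baseP n j) Q (lampRefl u) : ℤ)
        - lcnt (baseP n j) Q (lampRefl v)| := by
  have : NeZero n := ⟨by omega⟩
  by_contra hcon
  push Not at hcon
  set T := (lampDist n u v - 1) / 50 with hT
  have hpos := abs_nonneg ((lcnt (baseP n 0) 0 u : ℤ) - lcnt (baseP n 0) 0 v)
  have h00 := hcon 0 (by norm_num) 0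
  have hA : ∀ j < 8, ∀ Q, |(lcnt (baseP n j) Q u : ℤ) - lcnt (baseP n j) Q v| ≤ T := by
    intro j hj Q
    have := (hcon j hj Q).1
    omega
  have hB : ∀ j < 8, ∀ Q, |(lcnt (baseP n j) Q (lampRefl u) : ℤ)
        - lcnt (baseP n j) Q (lampRefl v)| ≤ T := by
    intro j hj Q
    have := (hcon j hj Q).2
    omega
  have hsum : ∀ a : ZMod n, a.val + (-a - 1).val = n - 1 := by
    intro a
    have ha := ZMod.val_lt a
    have e : -a - 1 = ((n - 1 - a.val : ℕ) : ZMod n) := by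
      rw [Nat.cast_sub (by omega), Nat.cast_sub (by omega)]; simp; ring
    rw [e, ZMod.val_natCast_of_lt (by omega)]; omega
  have hedge : ∀ z, (z ∈ u.1 ↔ z ∈ v.1) ∨ (∃ i : ℕ, i < 12 * T ∧ z = u.2 + 1 + i) ∨
      ∃ i : ℕ, i < 12 * T ∧ z = u.2 - i := by
    intro z
    by_cases hz : (z ∈ u.1 ↔ z ∈ v.1)
    · exact Or.inl hz
    · right
      have h1 := hsum (u.2 - z)
      rcases (by omega : 2 * (u.2 - z).val ≤ n - 1 ∨ 2 * (-(u.2 - z) - 1).val ≤ n - 1) with h | h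
      · right
        obtain ⟨j, hj, Q, hQ⟩ := detect_edge hn u.2 v.2 z u.1 v.1 hz h
        have : |(lcnt (baseP n j) Q (u.1, u.2) : ℤ) - lcnt (baseP n j) Q (v.1, v.2)| ≤ T := hA j hj Q
        refine ⟨(u.2 - z).val, by omega, by simp⟩
      · left
        have e : (lampRefl u).2 - (1 - z) = -(u.2 - z) - 1 := by simp [lampRefl]; ring
        obtain ⟨j, hj, Q, hQ⟩ := detect_edge hn (lampRefl u).2 (lampRefl v).2 (1 - z)
          (lampRefl u).1 (lampRefl v).1 (by simpa [lampRefl] using hz) (by rw [e]; exact h)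
        have : |(lcnt (baseP n j) Q ((lampRefl u).1, (lampRefl u).2) : ℤ)
          - lcnt (baseP n j) Q ((lampRefl v).1, (lampRefl v).2)| ≤ T := hB j hj Q
        rw [e] at hQ
        refine ⟨(-(u.2 - z) - 1).val, by omega, by simp⟩
  have hmove : ∃ d : ℕ, d ≤ 2 * T ∧ (v.2 = u.2 + d ∨ v.2 = u.2 - d) := by
    have hs : (u.2 - v.2).val + (v.2 - u.2).val ≤ n := by
      have := hsum (u.2 - v.2)
      rcases val_succ_cases hn (-(u.2 - v.2) - 1) with ⟨_, h⟩ | ⟨_, h⟩ <;>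
        rw [show -(u.2 - v.2) - 1 + 1 = v.2 - u.2 by ring] at h <;> omega
    rcases (by omega : 2 * (u.2 - v.2).val ≤ n ∨ 2 * (v.2 - u.2).val ≤ n) with h | h
    · obtain ⟨j, hj, hQ⟩ := detect_pos hn u.2 v.2 u.1 v.1 h
      have : |(lcnt (baseP n j) 0 (u.1, u.2) : ℤ) - lcnt (baseP n j) 0 (v.1, v.2)| ≤ T := hA j hj 0
      refine ⟨(u.2 - v.2).val, by omega, Or.inr (by simp)⟩
    · obtain ⟨j, hj, hQ⟩ := detect_pos hn v.2 u.2 v.1 u.1 h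
      have : |(lcnt (baseP n j) 0 (u.1, u.2) : ℤ) - lcnt (baseP n j) 0 (v.1, v.2)| ≤ T := hA j hj 0
      rw [abs_sub_comm] at this
      refine ⟨(v.2 - u.2).val, by omega, Or.inl (by simp)⟩
  obtain ⟨d, hd, hmv⟩ := hmove
  have := (reach_bound (12 * T) d u.2 v.2 u.1 v.1 hedge hmv).dist_le
  have h1 : (u.1, u.2) = u := rfl
  have h2 : (v.1, v.2) = v := rfl
  rw [h1, h2] at this
  omega

lemma blockSum_lip {n : ℕ} (hn : 2 ≤ n) {E : Type*} [NormedAddCommGroup E] (ψ : ℕ → E) (C : ℝ)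
    (hC : ∀ l, ‖ψ l‖ ≤ C) (p : ZMod n) (off : ℕ) (u v : Lamp n) (h : LEdge u v) :
    ‖blockSum ψ p off u - blockSum ψ p off v‖ ≤ C := by
  have : NeZero n := ⟨by omega⟩
  have hs := dep_step hn p u.2
  obtain ⟨h1, h2⟩ := h
  unfold blockSum
  apply sum_range_close
  · rw [h1]; exact hs.2
  · rw [h1]; exact hs.1
  · intro L hL1 hL2
    congr 2
    apply inkey_congr
    intro i hi
    unfold lampBits
    apply h2
    intro he
    -- i = (u.2 - p).val mod n
    have e : (i : ZMod n) = u.2 - p := by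
      have : p + 1 + (i : ZMod n) - (p + 1) = u.2 + 1 - (p + 1) := by rw [he]
      rw [add_sub_cancel_left] at this
      rw [this]; ring
    have hd := dep_le p u.2
    have e2 : i = (u.2 - p).val := by
      rw [← e, ZMod.val_natCast_of_lt (by omega)]
    rw [h1] at hL2
    unfold dep at hL1 hL2
    rw [← e2] at hL1
    have e3 : (u.2 + 1 - p) = (u.2 - p) + 1 := by ring
    rw [e3] at hL2
    rcases val_succ_cases hn (u.2 - p) with ⟨g1, g2⟩ | ⟨g1, g2⟩ <;> omega
  · exact le_trans (norm_nonneg _) (hC 0)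
  · intro L; exact hC _
  · intro L; exact hC _

end LampProof

namespace LampProof

/-- The James-type data produced by a non-superreflexive space. -/
def JData (X : Type*) [NormedAddCommGroup X] [NormedSpace ℝ X] : Prop :=
  ∃ K > (0 : ℝ), ∀ δ > (0 : ℝ), ∀ N : ℕ, ∃ y : ℕ → X, (∀ l, ‖y l‖ ≤ 1) ∧
    ∀ a b, a ≤ b → b ≤ N → ∃ h : X →L[ℝ] ℝ, ‖h‖ ≤ K ∧
      ∀ l, |h (y l) - (if a ≤ l ∧ l < b then 1 else 0)| ≤ δ

noncomputable def lampSum (n : ℕ) {E : Type*} [AddCommMonoid E] (ψ : ℕ → E) (u : Lamp n) : E :=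
  ∑ j ∈ Finset.range 8, (blockSum ψ (baseP n j) (j * 2 ^ (n + 1)) u +
    blockSum ψ (baseP n j) ((8 + j) * 2 ^ (n + 1)) (lampRefl u))

lemma lampSum_lip {n : ℕ} (hn : 2 ≤ n) {E : Type*} [NormedAddCommGroup E] (ψ : ℕ → E) (C : ℝ)
    (hC : ∀ l, ‖ψ l‖ ≤ C) (u v : Lamp n) :
    ‖lampSum n ψ u - lampSum n ψ v‖ ≤ 16 * C * lampDist n u v := by
  have : NeZero n := ⟨by omega⟩
  rw [← dist_eq_norm]
  apply lip_of_edge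
  intro u v h
  rw [dist_eq_norm]
  unfold lampSum
  rw [← Finset.sum_sub_distrib]
  calc _ ≤ ∑ j ∈ Finset.range 8, (2 * C) := by
        apply norm_sum_le_of_le
        intro j _
        rw [add_sub_add_comm]
        refine (norm_add_le _ _).trans ?_
        have h1 := blockSum_lip hn ψ C hC (baseP n j) (j * 2 ^ (n + 1)) u v h
        have h2 := blockSum_lip hn ψ C hC (baseP n j) ((8 + j) * 2 ^ (n + 1)) _ _ (lampRefl_edge h)
        rw [norm_sub_rev] at h2
        linarith
    _ = _ := by simp; ring

lemma block_ind {n : ℕ} (p : ZMod n) (β γ Q : ℕ) (u : Lamp n) :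
    blockSum (fun l => if β * 2 ^ (n + 1) + min Q (2 ^ (n + 1)) ≤ l ∧ l < (β + 1) * 2 ^ (n + 1)
      then (1 : ℝ) else 0) p (γ * 2 ^ (n + 1)) u = if γ = β then (lcnt p Q u : ℝ) else 0 := by
  classical
  unfold blockSum
  set W := 2 ^ (n + 1) with hW
  have hk : ∀ L ∈ Finset.range (dep n p u.2), inkey n (lampBits p u.1) (L + 1) < W := by
    intro L hL
    have := Finset.mem_range.1 hL
    have := dep_le p u.2
    exact inkey_lt _ _ _ (by omega)
  split_ifs with h
  · subst h
    unfold lcnt cnt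
    push_cast
    apply Finset.sum_congr rfl
    intro L hL
    have := hk L hL
    apply if_congr _ rfl rfl
    rw [add_mul]
    omega
  · apply Finset.sum_eq_zero
    intro L hL
    have := hk L hL
    beta_reduce
    rw [if_neg]
    rintro ⟨h1, h2⟩
    rcases lt_or_gt_of_ne h with h | h
    · have := Nat.mul_le_mul_right W (show γ + 1 ≤ β from h)
      rw [add_mul] at this
      omega
    · have := Nat.mul_le_mul_right W (show β + 1 ≤ γ from h)
      omega

lemma lampSum_ind1 {n : ℕ} (j Q : ℕ) (hj : j < 8) (u : Lamp n) :
    lampSum n (fun l => if j * 2 ^ (n + 1) + min Q (2 ^ (n + 1)) ≤ l ∧ l < (j + 1) * 2 ^ (n + 1)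
      then (1 : ℝ) else 0) u = lcnt (baseP n j) Q u := by
  unfold lampSum
  simp only [block_ind]
  rw [Finset.sum_eq_single j]
  · rw [if_pos rfl, if_neg (by omega), add_zero]
  · intro i _ hi
    rw [if_neg hi, if_neg (by omega), add_zero]
  · intro h; exact absurd (Finset.mem_range.2 hj) h

lemma lampSum_ind2 {n : ℕ} (j Q : ℕ) (hj : j < 8) (u : Lamp n) :
    lampSum n (fun l => if (8 + j) * 2 ^ (n + 1) + min Q (2 ^ (n + 1)) ≤ l ∧
      l < ((8 + j) + 1) * 2 ^ (n + 1)
      then (1 : ℝ) else 0) u = lcnt (baseP n j) Q (lampRefl u) := by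
  unfold lampSum
  simp only [block_ind]
  rw [Finset.sum_eq_single j]
  · rw [if_pos rfl, if_neg (by omega), zero_add]
  · intro i hi hi'
    have := Finset.mem_range.1 hi
    rw [if_neg (by omega), if_neg (by omega), add_zero]
  · intro h; exact absurd (Finset.mem_range.2 hj) h

lemma lampSum_map {n : ℕ} {X : Type*} [NormedAddCommGroup X] [NormedSpace ℝ X]
    (h : X →L[ℝ] ℝ) (y : ℕ → X) (u : Lamp n) :
    h (lampSum n y u) = lampSum n (fun l => h (y l)) u := by
  simp [lampSum, blockSum, map_sum]

lemma lampSum_sub {n : ℕ} (a b : ℕ → ℝ) (u : Lamp n) :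
    lampSum n (fun l => a l - b l) u = lampSum n a u - lampSum n b u := by
  simp only [lampSum, blockSum]
  rw [← Finset.sum_sub_distrib]
  apply Finset.sum_congr rfl
  intro i _
  rw [Finset.sum_sub_distrib, Finset.sum_sub_distrib]
  ring

theorem embed_of_jdata (X : Type*) [NormedAddCommGroup X] [NormedSpace ℝ X] (H : JData X) :
    ∃ D : ℝ, 1 ≤ D ∧ ∀ n : ℕ, 2 ≤ n →
        ∃ (f : Lamp n → X) (r : ℝ), 0 < r ∧
          ∀ u v : Lamp n,
            r * (lampDist n u v : ℝ) ≤ ‖f u - f v‖ ∧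
            ‖f u - f v‖ ≤ D * r * (lampDist n u v : ℝ) := by
  obtain ⟨K, hK, H⟩ := H
  refine ⟨max 1 (1600 * K), le_max_left _ _, fun n hn => ?_⟩
  obtain ⟨y, hy, hy2⟩ := H (1 / 1600) (by norm_num) (16 * 2 ^ (n + 1))
  refine ⟨lampSum n y, 1 / (100 * K), by positivity, fun u v => ⟨?_, ?_⟩⟩
  · set ρ : ℝ := (lampDist n u v : ℝ) with hρ
    have key : ∃ β < 16, ∃ Q : ℕ, ρ ≤ 50 *
        |lampSum n (fun l => if β * 2 ^ (n + 1) + min Q (2 ^ (n + 1)) ≤ l ∧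
          l < (β + 1) * 2 ^ (n + 1) then (1 : ℝ) else 0) u -
         lampSum n (fun l => if β * 2 ^ (n + 1) + min Q (2 ^ (n + 1)) ≤ l ∧
          l < (β + 1) * 2 ^ (n + 1) then (1 : ℝ) else 0) v| := by
      obtain ⟨j, hj, Q, h | h⟩ := detect hn u v
      · refine ⟨j, by omega, Q, ?_⟩
        rw [lampSum_ind1 j Q hj, lampSum_ind1 j Q hj]
        rw [hρ]
        exact_mod_cast h
      · refine ⟨8 + j, by omega, Q, ?_⟩
        rw [lampSum_ind2 j Q hj, lampSum_ind2 j Q hj]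
        rw [hρ]
        exact_mod_cast h
    obtain ⟨β, hβ, Q, hQ⟩ := key
    obtain ⟨h, hh1, hh2⟩ := hy2 (β * 2 ^ (n + 1) + min Q (2 ^ (n + 1))) ((β + 1) * 2 ^ (n + 1))
      (by rw [add_mul]; omega) (Nat.mul_le_mul_right _ (by omega))
    have e1 := lampSum_lip hn (fun l => h (y l) - (if β * 2 ^ (n + 1) + min Q (2 ^ (n + 1)) ≤ l ∧
          l < (β + 1) * 2 ^ (n + 1) then (1 : ℝ) else 0)) (1 / 1600) hh2 u v
    rw [lampSum_sub, lampSum_sub, ← lampSum_map, ← lampSum_map, Real.norm_eq_abs] at e1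
    have e2 : |h (lampSum n y u - lampSum n y v)| ≤ K * ‖lampSum n y u - lampSum n y v‖ :=
      (h.le_opNorm _).trans (mul_le_mul_of_nonneg_right hh1 (norm_nonneg _))
    rw [map_sub] at e2
    generalize h (lampSum n y u) = p at *
    generalize h (lampSum n y v) = q at *
    set a := lampSum n (fun l => if β * 2 ^ (n + 1) + min Q (2 ^ (n + 1)) ≤ l ∧
          l < (β + 1) * 2 ^ (n + 1) then (1 : ℝ) else 0) u
    set b := lampSum n (fun l => if β * 2 ^ (n + 1) + min Q (2 ^ (n + 1)) ≤ l ∧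
          l < (β + 1) * 2 ^ (n + 1) then (1 : ℝ) else 0) v
    have e3 : |a - b| ≤ |p - q| + |p - a - (q - b)| := by
      have := abs_sub (p - q) (p - a - (q - b))
      rwa [show p - q - (p - a - (q - b)) = a - b by ring] at this
    have : ρ ≤ 100 * K * ‖lampSum n y u - lampSum n y v‖ := by
      linarith
    rw [one_div, inv_mul_le_iff₀ (by positivity)]
    exact this
  · have := lampSum_lip hn y 1 hy u v
    refine this.trans (mul_le_mul_of_nonneg_right ?_ (by positivity))
    calc (16 * 1 : ℝ) = (1600 * K) * (1 / (100 * K)) := by field_simp; norm_num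
      _ ≤ _ := mul_le_mul_of_nonneg_right (le_max_right _ _) (by positivity)

end LampProof

namespace LampProof
section
variable {X : Type*} [NormedAddCommGroup X] [NormedSpace ℝ X]

/-- roots of dyadic `ε`-separated trees of height `n` in `C` -/
def tree (ε : ℝ) (C : Set X) : ℕ → Set X
  | 0 => C
  | n + 1 => {x | ∃ y ∈ tree ε C n, ∃ z ∈ tree ε C n, ε ≤ ‖y - z‖ ∧ x = (1 / 2 : ℝ) • (y + z)}

lemma tree_mono {ε : ℝ} {C C' : Set X} (h : C ⊆ C') (n : ℕ) : tree ε C n ⊆ tree ε C' n := by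
  induction n with
  | zero => exact h
  | succ n ih =>
    rintro x ⟨y, hy, z, hz, h1, h2⟩
    exact ⟨y, ih hy, z, ih hz, h1, h2⟩

lemma tree_tree (ε : ℝ) (C : Set X) (j m : ℕ) : tree ε (tree ε C j) m = tree ε C (j + m) := by
  induction m with
  | zero => rfl
  | succ m ih =>
    rw [← add_assoc]
    simp only [tree, ih]

lemma tree_succ_sub {ε : ℝ} {C : Set X} (hC : Convex ℝ C) (n : ℕ) :
    tree ε C (n + 1) ⊆ tree ε C n := by
  have h1 : tree ε C 1 ⊆ C := by
    rintro x ⟨y, hy, z, hz, -, rfl⟩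
    rw [smul_add]
    exact hC hy hz (by norm_num) (by norm_num) (by norm_num)
  rw [add_comm, ← tree_tree]
  exact tree_mono h1 n

lemma tree_anti {ε : ℝ} {C : Set X} (hC : Convex ℝ C) {m n : ℕ} (h : m ≤ n) :
    tree ε C n ⊆ tree ε C m := by
  induction n, h using Nat.le_induction with
  | base => exact subset_rfl
  | succ n _ ih => exact (tree_succ_sub hC n).trans ih

lemma tree_le {ε : ℝ} {C : Set X} (f : X →L[ℝ] ℝ) (u : ℝ) (h : ∀ x ∈ C, f x ≤ u) (n : ℕ) :
    ∀ x ∈ tree ε C n, f x ≤ u := by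
  induction n with
  | zero => exact h
  | succ n ih =>
    rintro x ⟨y, hy, z, hz, -, rfl⟩
    have h1 := ih y hy
    have h2 := ih z hz
    rw [map_smul, map_add, smul_eq_mul]
    linarith

def strip (C : Set X) (f : X →L[ℝ] ℝ) (u δ : ℝ) : Set X := {x | x ∈ C ∧ u - δ ≤ f x ∧ f x ≤ u}

lemma strip_convex {C : Set X} (hC : Convex ℝ C) (f : X →L[ℝ] ℝ) (u δ : ℝ) :
    Convex ℝ (strip C f u δ) := by
  have : strip C f u δ = C ∩ (f ⁻¹' Set.Icc (u - δ) u) := rfl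
  rw [this]
  exact hC.inter ((convex_Icc _ _).is_linear_preimage f.isBoundedLinearMap.toIsLinearMap)

lemma strip_sub (C : Set X) (f : X →L[ℝ] ℝ) (u δ : ℝ) : strip C f u δ ⊆ C := fun _ h => h.1

lemma strip_mono {C C' : Set X} (h : C ⊆ C') (f : X →L[ℝ] ℝ) (u δ : ℝ) :
    strip C f u δ ⊆ strip C' f u δ := fun _ hx => ⟨h hx.1, hx.2⟩

lemma claimA {ε : ℝ} {C : Set X} (f : X →L[ℝ] ℝ) (u δ : ℝ) (h : ∀ x ∈ C, f x ≤ u) (j : ℕ) :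
    ∀ x ∈ tree ε C j, u - δ / 2 ^ j ≤ f x → x ∈ tree ε (strip C f u δ) j := by
  induction j with
  | zero => intro x hx hf; exact ⟨hx, by simpa using hf, h x hx⟩
  | succ j ih =>
    rintro x ⟨y, hy, z, hz, h1, rfl⟩ hf
    have hy' := tree_le f u h j y hy
    have hz' := tree_le f u h j z hz
    rw [map_smul, map_add, smul_eq_mul] at hf
    have e : δ / 2 ^ (j + 1) = δ / 2 ^ j / 2 := by rw [pow_succ]; field_simp
    rw [e] at hf
    exact ⟨y, ih y hy (by linarith), z, ih z hz (by linarith), h1, rfl⟩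

lemma slice_aux {ε : ℝ} {C : Set X} (hC : Convex ℝ C) (f : X →L[ℝ] ℝ) (δ : ℝ) (j s : ℕ) :
    ∀ (i : ℕ) (u : ℝ) (x : X), (∀ p ∈ tree ε C i, f p ≤ u) → x ∈ tree ε C (i + s * j) →
      u - s * (δ / 2 ^ j) < f x → ∃ u', f x ≤ u' ∧ (tree ε (strip C f u' δ) j).Nonempty := by
  induction s with
  | zero =>
    intro i u x h hx hf
    have := h x (by simpa using hx)
    simp at hf; linarith
  | succ s ih =>
    intro i u x h hx hf
    by_cases hp : ∃ p ∈ tree ε C (i + j), u - δ / 2 ^ j ≤ f p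
    · obtain ⟨p, hp, hfp⟩ := hp
      refine ⟨u, h x (tree_anti hC (Nat.le_add_right _ _) hx), p, ?_⟩
      rw [← tree_tree] at hp
      exact tree_mono (strip_mono (tree_anti hC (Nat.zero_le i)) f u δ) j (claimA f u δ h j p hp hfp)
    · push Not at hp
      refine ih (i + j) (u - δ / 2 ^ j) x (fun p hp' => (hp p hp').le) ?_ ?_
      · rw [add_mul, one_mul] at hx
        rwa [add_assoc, add_comm j]
      · push_cast at hf; linarith

lemma slice (ε : ℝ) (j : ℕ) (δ : ℝ) (hδ : 0 < δ) : ∃ m : ℕ, ∀ C : Set X, Convex ℝ C →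
    C ⊆ Metric.closedBall 0 1 → ∀ f : X →L[ℝ] ℝ, ‖f‖ ≤ 1 → ∀ x ∈ tree ε C m,
      ∃ u', f x ≤ u' ∧ (tree ε (strip C f u' δ) j).Nonempty := by
  have hη : 0 < δ / 2 ^ j := by positivity
  obtain ⟨s, hs⟩ := exists_nat_gt (2 / (δ / 2 ^ j))
  rw [div_lt_iff₀ hη] at hs
  refine ⟨s * j, fun C hC hCb f hf x hx => ?_⟩
  have hb : ∀ p ∈ C, |f p| ≤ 1 := by
    intro p hp
    have h1 := hCb hp
    rw [mem_closedBall_zero_iff] at h1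
    calc |f p| = ‖f p‖ := rfl
      _ ≤ ‖f‖ * ‖p‖ := f.le_opNorm p
      _ ≤ 1 := by nlinarith [norm_nonneg f, norm_nonneg p]
  refine slice_aux hC f δ j s 0 1 x (fun p hp => (abs_le.1 (hb p hp)).2) (by simpa using hx) ?_
  have := (abs_le.1 (hb x (tree_anti hC (Nat.zero_le _) hx))).1
  linarith

lemma sep (ε : ℝ) (hε : 0 < ε) (M : ℕ) : ∀ j' : ℕ, ∃ J : ℕ, ∀ C : Set X, Convex ℝ C →
    C ⊆ Metric.closedBall 0 1 → (tree ε C J).Nonempty → ∃ p : ℕ → X,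
      (∀ i < M, p i ∈ tree ε C j') ∧ ∀ i k, i < k → k < M → ε / 2 ≤ ‖p i - p k‖ := by
  induction M with
  | zero => intro j'; exact ⟨0, fun C _ _ _ => ⟨fun _ => 0, by simp, by simp⟩⟩
  | succ M ih =>
    intro j'
    obtain ⟨J, hJ⟩ := ih j'
    obtain ⟨m, hm⟩ := slice (X := X) ε J (ε / 8) (by positivity)
    refine ⟨max m j' + 1, fun C hC hCb hne => ?_⟩
    obtain ⟨x, y, hy, z, hz, hyz, rfl⟩ := hne
    obtain ⟨g, hg1, hg2⟩ := exists_dual_vector'' ℝ (y - z)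
    obtain ⟨u, hu, hne⟩ := hm C hC hCb g hg1 y (tree_anti hC (le_max_left _ _) hy)
    obtain ⟨p, hp1, hp2⟩ := hJ _ (strip_convex hC g u _) ((strip_sub _ _ _ _).trans hCb) hne
    have hgyz : g y - g z = ‖y - z‖ := by rw [← map_sub, hg2]; rfl
    refine ⟨fun i => Nat.casesOn i z p, ?_, ?_⟩
    · intro i hi
      cases i with
      | zero => exact tree_anti hC (le_max_right _ _) hz
      | succ i => exact tree_mono (strip_sub _ _ _ _) _ (hp1 i (by omega))
    · intro i k hik hk
      cases k with
      | zero => omega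
      | succ k =>
        cases i with
        | zero =>
          have := tree_anti (strip_convex hC g u _) (Nat.zero_le _) (hp1 k (by omega))
          have h3 := this.2.1
          have h4 : g (p k - z) ≤ ‖p k - z‖ := by
            refine (le_abs_self _).trans ((g.le_opNorm _).trans ?_)
            nlinarith [norm_nonneg (p k - z)]
          rw [map_sub] at h4
          change ε / 2 ≤ ‖z - p k‖
          rw [norm_sub_rev]
          linarith
        | succ i => exact hp2 i k (by omega) (by omega)

end
end LampProof

namespace LampProof
section
open MeasureTheory Metric Module
open scoped ENNReal

lemma card_sep {E : Type*} [NormedAddCommGroup E] [NormedSpace ℝ E] [FiniteDimensional ℝ E]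
    (s : Finset E) (R σ : ℝ) (hR : 0 ≤ R) (hσ : 0 < σ) (hs : ∀ c ∈ s, ‖c‖ ≤ R)
    (h : ∀ c ∈ s, ∀ d ∈ s, c ≠ d → σ ≤ ‖c - d‖) :
    (s.card : ℝ) ≤ ((R + σ / 2) / (σ / 2)) ^ finrank ℝ E := by
  borelize E
  let μ : Measure E := Measure.addHaar
  let δ : ℝ := σ / 2
  let ρ : ℝ := R + σ / 2
  have ρpos : 0 < ρ := by positivity
  have δpos : 0 < δ := by positivity
  set A := ⋃ c ∈ s, ball (c : E) δ with hA
  have D : Set.Pairwise (s : Set E) (Function.onFun Disjoint fun c => ball (c : E) δ) := by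
    rintro c hc d hd hcd
    apply ball_disjoint_ball
    rw [dist_eq_norm]
    have := h c hc d hd hcd
    simp only [δ]; linarith
  have A_subset : A ⊆ ball (0 : E) ρ := by
    refine Set.iUnion₂_subset fun x hx => ?_
    apply ball_subset_ball'
    rw [dist_zero_right]
    have := hs x hx
    simp only [δ, ρ]; linarith
  have I :
    (s.card : ℝ≥0∞) * ENNReal.ofReal (δ ^ finrank ℝ E) * μ (ball 0 1) ≤
      ENNReal.ofReal (ρ ^ finrank ℝ E) * μ (ball 0 1) :=
    calc
      (s.card : ℝ≥0∞) * ENNReal.ofReal (δ ^ finrank ℝ E) * μ (ball 0 1) = μ A := by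
        rw [hA, measure_biUnion_finset D fun c _ => measurableSet_ball]
        simp only [μ.addHaar_ball_of_pos _ δpos]
        simp only [Finset.sum_const, nsmul_eq_mul, mul_assoc]
      _ ≤ μ (ball (0 : E) ρ) := measure_mono A_subset
      _ = ENNReal.ofReal (ρ ^ finrank ℝ E) * μ (ball 0 1) := by
        simp only [μ.addHaar_ball_of_pos _ ρpos]
  have J : (s.card : ℝ≥0∞) * ENNReal.ofReal (δ ^ finrank ℝ E) ≤ ENNReal.ofReal (ρ ^ finrank ℝ E) :=
    (ENNReal.mul_le_mul_iff_left (measure_ball_pos _ _ zero_lt_one).ne' measure_ball_lt_top.ne).1 I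
  have := ENNReal.toReal_le_of_le_ofReal (pow_nonneg ρpos.le _) J
  rw [ENNReal.toReal_mul, ENNReal.toReal_ofReal (by positivity), ENNReal.toReal_natCast] at this
  change _ ≤ (ρ / δ) ^ _
  rw [div_pow, le_div_iff₀ (by positivity)]
  exact this

variable {X : Type*} [NormedAddCommGroup X] [NormedSpace ℝ X]

lemma away (ε : ℝ) (hε : 0 < ε) (k j' : ℕ) : ∃ J : ℕ, ∀ C : Set X, Convex ℝ C →
    C ⊆ Metric.closedBall 0 1 → (tree ε C J).Nonempty → ∀ V : Submodule ℝ X,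
      FiniteDimensional ℝ V → finrank ℝ V ≤ k → ∃ x ∈ tree ε C j', ε / 8 ≤ infDist x V := by
  classical
  obtain ⟨M, hM⟩ := exists_nat_gt ((((1 + ε / 8) + (ε / 4) / 2) / ((ε / 4) / 2)) ^ k)
  obtain ⟨J, hJ⟩ := sep (X := X) ε hε M j'
  refine ⟨J, fun C hC hCb hne V hfd hV => ?_⟩
  by_contra hcon
  push Not at hcon
  obtain ⟨p, hp1, hp2⟩ := hJ C hC hCb hne
  have hv : ∀ i, ∃ v : V, i < M → dist (p i) v < ε / 8 := by
    intro i
    by_cases hi : i < M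
    · obtain ⟨v, hv, hd⟩ := (infDist_lt_iff (s := (V : Set X)) ⟨0, V.zero_mem⟩).1
        (hcon (p i) (hp1 i hi))
      exact ⟨⟨v, hv⟩, fun _ => hd⟩
    · exact ⟨0, fun h => absurd h hi⟩
  choose v hv using hv
  have hsep : ∀ i k, i < k → k < M → ε / 4 ≤ ‖v i - v k‖ := by
    intro i k hik hk
    have h1 := hv i (by omega)
    have h2 := hv k hk
    have h3 := hp2 i k hik hk
    rw [← dist_eq_norm] at h3 ⊢
    have h4 := dist_triangle4 (p i) (v i) (v k) (p k)
    rw [dist_comm (v k : X) (p k)] at h4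
    have h5 : dist (v i : X) (v k) = dist (v i) (v k) := rfl
    linarith
  have hinj : Set.InjOn v (Finset.range M : Set ℕ) := by
    intro i hi k hk hik
    simp only [Finset.coe_range, Set.mem_Iio] at hi hk
    by_contra hne
    rcases lt_or_gt_of_ne hne with h | h
    · have := hsep i k h hk
      rw [hik, sub_self, norm_zero] at this; linarith
    · have := hsep k i h hi
      rw [hik, sub_self, norm_zero] at this; linarith
  have hcard := card_sep ((Finset.range M).image v) (1 + ε / 8) (ε / 4) (by positivity)
    (by positivity) ?_ ?_
  · rw [Finset.card_image_of_injOn hinj, Finset.card_range] at hcard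
    have : (((1 + ε / 8) + (ε / 4) / 2) / ((ε / 4) / 2)) ^ finrank ℝ V ≤
      (((1 + ε / 8) + (ε / 4) / 2) / ((ε / 4) / 2)) ^ k := by
      apply pow_le_pow_right₀ _ hV
      rw [le_div_iff₀ (by positivity)]
      linarith
    linarith
  · intro c hc
    obtain ⟨i, hi, rfl⟩ := Finset.mem_image.1 hc
    have h1 := hv i (Finset.mem_range.1 hi)
    have h2 := hCb (tree_anti hC (Nat.zero_le _) (hp1 i (Finset.mem_range.1 hi)))
    rw [mem_closedBall_zero_iff] at h2
    have h3 := norm_le_norm_add_norm_sub (p i) (v i : X)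
    rw [← dist_eq_norm] at h3
    have h4 : ‖(v i : X)‖ = ‖v i‖ := rfl
    linarith
  · intro c hc d hd hcd
    obtain ⟨i, hi, rfl⟩ := Finset.mem_image.1 hc
    obtain ⟨l, hl, rfl⟩ := Finset.mem_image.1 hd
    rw [Finset.mem_range] at hi hl
    rcases lt_trichotomy i l with h | h | h
    · exact hsep i l h hl
    · subst h; exact absurd rfl hcd
    · rw [norm_sub_rev]; exact hsep l i h hi

lemma dual_away (V : Submodule ℝ X) (x : X) : ∃ f : X →L[ℝ] ℝ, ‖f‖ ≤ 1 ∧ (∀ v ∈ V, f v = 0) ∧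
    f x = infDist x V := by
  obtain ⟨g, hg1, hg2⟩ := exists_dual_vector'' ℝ (Submodule.Quotient.mk x : X ⧸ V)
  refine ⟨g.comp V.mkQL, ?_, ?_, ?_⟩
  · apply ContinuousLinearMap.opNorm_le_bound _ zero_le_one
    intro z
    refine (g.le_opNorm _).trans ?_
    have : ‖V.mkQL z‖ ≤ ‖z‖ := Submodule.Quotient.norm_mk_le V z
    exact mul_le_mul hg1 this (norm_nonneg _) zero_le_one
  · intro v hv
    have : V.mkQL v = 0 := (Submodule.Quotient.mk_eq_zero V).2 hv
    simp [ContinuousLinearMap.comp_apply, this]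
  · have : g (Submodule.Quotient.mk x) = infDist x V := by
      rw [hg2]
      exact QuotientAddGroup.norm_mk (S := V.toAddSubgroup) x
    exact this

lemma ext (ε : ℝ) (hε : 0 < ε) (δ : ℝ) (hδ : 0 < δ) (k : ℕ) : ∀ j : ℕ, ∃ D : ℕ, ∀ C : Set X,
    Convex ℝ C → C ⊆ Metric.closedBall 0 1 → (tree ε C D).Nonempty →
    ∃ (y : ℕ → X) (f : ℕ → X →L[ℝ] ℝ) (u : ℕ → ℝ) (C' : Set X), Convex ℝ C' ∧ C' ⊆ C ∧
      (tree ε C' j).Nonempty ∧ ∀ i < k, y i ∈ C ∧ ‖f i‖ ≤ 1 ∧ ε / 8 ≤ u i ∧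
        (∀ l < i, f i (y l) = 0) ∧
        (∀ l < k, i ≤ l → u i - δ ≤ f i (y l) ∧ f i (y l) ≤ u i) ∧
        ∀ p ∈ C', u i - δ ≤ f i p ∧ f i p ≤ u i := by
  classical
  induction k with
  | zero =>
    intro j
    exact ⟨j, fun C hC hCb hne => ⟨fun _ => 0, fun _ => 0, fun _ => 0, C, hC, subset_rfl, hne,
      by simp⟩⟩
  | succ k ih =>
    intro j
    obtain ⟨m, hm⟩ := slice (X := X) ε j δ hδ
    obtain ⟨J, hJ⟩ := away (X := X) ε hε k m
    obtain ⟨D, hD⟩ := ih J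
    refine ⟨D, fun C hC hCb hne => ?_⟩
    obtain ⟨y, f, u, C', hC', hC'C, hne', H⟩ := hD C hC hCb hne
    let V : Submodule ℝ X := Submodule.span ℝ (((Finset.range k).image y : Finset X) : Set X)
    have hVk : finrank ℝ V ≤ k := by
      refine (finrank_span_finset_le_card _).trans ?_
      exact (Finset.card_image_le).trans (by simp)
    obtain ⟨x, hx, hxV⟩ := hJ C' hC' (hC'C.trans hCb) hne' V inferInstance hVk
    obtain ⟨g, hg1, hg2, hg3⟩ := dual_away V x
    obtain ⟨w, hw, hne''⟩ := hm C' hC' (hC'C.trans hCb) g hg1 x hx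
    set C'' := strip C' g w δ with hC''
    have hconv : Convex ℝ C'' := strip_convex hC' g w δ
    obtain ⟨q, hq⟩ := hne''
    have hq' : q ∈ C'' := tree_anti hconv (Nat.zero_le j) hq
    refine ⟨fun l => if l < k then y l else q, fun i => if i < k then f i else g,
      fun i => if i < k then u i else w, C'', hconv, (strip_sub _ _ _ _).trans hC'C, ⟨q, hq⟩, ?_⟩
    intro i hi
    by_cases hik : i < k
    · obtain ⟨h1, h2, h3, h4, h5, h6⟩ := H i hik
      simp only [hik, if_true]
      refine ⟨h1, h2, h3, ?_, ?_, ?_⟩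
      · intro l hl
        rw [if_pos (by omega)]; exact h4 l hl
      · intro l hl hil
        by_cases hlk : l < k
        · simp only [hlk, if_true]; exact h5 l hlk hil
        · simp only [hlk, if_false]; exact h6 q hq'.1
      · intro p hp; exact h6 p hp.1
    · have : i = k := by omega
      subst this
      simp only [lt_irrefl, if_false]
      refine ⟨hC'C hq'.1, hg1, by linarith, ?_, ?_, ?_⟩
      · intro l hl
        rw [if_pos hl]
        apply hg2
        apply Submodule.subset_span
        simp only [Finset.coe_image, Finset.coe_range]
        exact ⟨l, hl, rfl⟩
      · intro l hl hil
        rw [if_neg (by omega)]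
        exact hq'.2
      · intro p hp; exact hp.2

theorem jdata_of_tree (ε : ℝ) (hε : 0 < ε)
    (H : ∀ n, (tree ε (Metric.closedBall (0 : X) 1) n).Nonempty) : JData X := by
  set θ := ε / 8 with hθ
  have hθ0 : 0 < θ := by positivity
  refine ⟨2 / θ, by positivity, fun δ hδ N => ?_⟩
  obtain ⟨D, hD⟩ := ext (X := X) ε hε (δ * θ / 2) (by positivity) N 0
  obtain ⟨y, f, u, C', -, -, -, HH⟩ := hD _ (convex_closedBall 0 1) subset_rfl (H D)
  refine ⟨fun l => if l < N then y l else 0, ?_, ?_⟩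
  · intro l
    by_cases hl : l < N
    · simp only [hl, if_true]
      simpa using (HH l hl).1
    · simp [hl]
  · have key : ∀ a, ∃ g : X →L[ℝ] ℝ, ‖g‖ ≤ 1 / θ ∧
        ∀ l, |g (if l < N then y l else 0) - (if a ≤ l ∧ l < N then 1 else 0)| ≤ δ / 2 := by
      intro a
      by_cases ha : a < N
      · obtain ⟨h1, h2, h3, h4, h5, h6⟩ := HH a ha
        have hu : 0 < u a := by linarith
        refine ⟨(u a)⁻¹ • f a, ?_, ?_⟩
        · rw [norm_smul, Real.norm_eq_abs, abs_of_pos (by positivity), one_div]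
          have : (u a)⁻¹ ≤ θ⁻¹ := inv_anti₀ hθ0 h3
          have : 0 < (u a)⁻¹ := by positivity
          nlinarith [norm_nonneg (f a)]
        · intro l
          by_cases hl : l < N
          · simp only [hl, if_true, and_true]
            rw [smul_apply, smul_eq_mul]
            by_cases hal : a ≤ l
            · rw [if_pos hal]
              have := h5 l hl hal
              have e : (u a)⁻¹ * f a (y l) - 1 = (f a (y l) - u a) / u a := by field_simp
              rw [e, abs_div, abs_of_pos hu, div_le_iff₀ hu, abs_le]
              constructor <;> nlinarith
            · rw [if_neg hal, h4 l (by omega)]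
              simp; positivity
          · simp [hl]; positivity
      · refine ⟨0, by simp; positivity, fun l => ?_⟩
        rw [if_neg (show ¬ (a ≤ l ∧ l < N) by omega)]
        simp; positivity
    intro a b hab hbN
    obtain ⟨g, hg1, hg2⟩ := key a
    obtain ⟨g', hg1', hg2'⟩ := key b
    refine ⟨g - g', ?_, ?_⟩
    · refine (norm_sub_le _ _).trans ?_
      have : 2 / θ = 1 / θ + 1 / θ := by ring
      linarith
    · intro l
      have h1 := hg2 l
      have h2 := hg2' l
      have e : (if a ≤ l ∧ l < b then (1 : ℝ) else 0) = (if a ≤ l ∧ l < N then 1 else 0) -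
          (if b ≤ l ∧ l < N then 1 else 0) := by
        split_ifs <;> first | omega | norm_num
      rw [e, sub_apply]
      rw [abs_le] at *
      constructor <;> linarith [h1.1, h1.2, h2.1, h2.2]

end
end LampProof

namespace LampProof
section
open Metric
variable {X : Type*} [NormedAddCommGroup X] [NormedSpace ℝ X]

lemma exists_phi (ε : ℝ) (n : ℕ) (h : ¬ (tree ε (closedBall (0 : X) 1) n).Nonempty) :
    ∃ φ : X → ℝ, (∀ x, 0 ≤ φ x ∧ φ x ≤ 1) ∧ ∃ δ > (0 : ℝ), ∀ x ∈ closedBall (0 : X) 1,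
      ∀ y ∈ closedBall (0 : X) 1, ε ≤ ‖x - y‖ →
        φ ((1 / 2 : ℝ) • (x + y)) ≤ (φ x + φ y) / 2 - δ := by
  classical
  let r : X → ℕ := fun x => Nat.findGreatest (fun j => x ∈ tree ε (closedBall (0 : X) 1) j) n
  have hr : ∀ x ∈ closedBall (0 : X) 1, x ∈ tree ε (closedBall (0 : X) 1) (r x) := by
    intro x hx
    exact Nat.findGreatest_spec (P := fun j => x ∈ tree ε (closedBall (0 : X) 1) j)
      (Nat.zero_le n) hx
  have hB := convex_closedBall (0 : X) 1
  have hrn : ∀ x, r x ≤ n := fun x => Nat.findGreatest_le n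
  refine ⟨fun x => (1 / 3) ^ r x, fun x => ⟨by positivity, pow_le_one₀ (by norm_num) (by norm_num)⟩,
    (1 / 3) ^ n / 6, by positivity, ?_⟩
  intro x hx y hy hxy
  set a := min (r x) (r y) with ha
  have hm : (1 / 2 : ℝ) • (x + y) ∈ tree ε (closedBall (0 : X) 1) (a + 1) :=
    ⟨x, tree_anti hB (min_le_left _ _) (hr x hx), y, tree_anti hB (min_le_right _ _) (hr y hy),
      hxy, rfl⟩
  have han : a + 1 ≤ n := by
    by_contra hc
    exact h ⟨_, tree_anti hB (by omega) hm⟩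
  have hra : a + 1 ≤ r ((1 / 2 : ℝ) • (x + y)) := Nat.le_findGreatest han hm
  have h1 : (1 / 3 : ℝ) ^ r ((1 / 2 : ℝ) • (x + y)) ≤ (1 / 3) ^ (a + 1) :=
    pow_le_pow_of_le_one (by norm_num) (by norm_num) hra
  have h2 : (1 / 3 : ℝ) ^ a ≤ (1 / 3) ^ r x + (1 / 3) ^ r y := by
    have p1 : (0 : ℝ) < (1 / 3) ^ r x := by positivity
    have p2 : (0 : ℝ) < (1 / 3) ^ r y := by positivity
    rcases min_choice (r x) (r y) with h | h <;> rw [ha, h] <;> linarith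
  have h3 : (1 / 3 : ℝ) ^ n ≤ (1 / 3) ^ a :=
    pow_le_pow_of_le_one (by norm_num) (by norm_num) (by omega)
  rw [pow_succ] at h1
  beta_reduce
  linarith

lemma exists_hull (ε : ℝ) (hε : 0 < ε) (n : ℕ)
    (h : ¬ (tree ε (closedBall (0 : X) 1) n).Nonempty) :
    ∃ g : X → ℝ, (∀ x ∈ closedBall (0 : X) 1, 0 ≤ g x ∧ g x ≤ 1) ∧
      (∀ x ∈ closedBall (0 : X) 1, ∀ y ∈ closedBall (0 : X) 1, ∀ a b : ℝ, 0 ≤ a → 0 ≤ b →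
        a + b = 1 → g (a • x + b • y) ≤ a * g x + b * g y) ∧
      ∃ δ > (0 : ℝ), ∀ x ∈ closedBall (0 : X) 1,
      ∀ y ∈ closedBall (0 : X) 1, 2 * ε ≤ ‖x - y‖ →
        g ((1 / 2 : ℝ) • (x + y)) ≤ (g x + g y) / 2 - δ := by
  obtain ⟨φ, hφ, δ, hδ, hgain⟩ := exists_phi ε n h
  let E : Set (X × ℝ) := {p | p.1 ∈ closedBall (0 : X) 1 ∧ φ p.1 ≤ p.2}
  let H := convexHull ℝ E
  have hHc : Convex ℝ H := convex_convexHull ℝ E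
  have hEH : E ⊆ H := subset_convexHull ℝ E
  have hH0 : ∀ p ∈ H, 0 ≤ p.2 := by
    have : H ⊆ {p : X × ℝ | 0 ≤ p.2} := by
      apply convexHull_min
      · intro p hp; exact (hφ p.1).1.trans hp.2
      · intro p hp q hq a b ha hb _
        simp only [Set.mem_ofPred_eq, Prod.snd_add, Prod.smul_snd, smul_eq_mul] at *
        positivity
    exact fun p hp => this hp
  -- upward closed
  have hup : ∀ c : ℝ, 0 ≤ c → ∀ p ∈ H, (p.1, p.2 + c) ∈ H := by
    intro c hc
    have : H ⊆ {p : X × ℝ | (p.1, p.2 + c) ∈ H} := by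
      apply convexHull_min
      · intro p hp
        exact hEH ⟨hp.1, by have := hp.2; simp only; linarith⟩
      · intro p hp q hq a b ha hb hab
        have := hHc hp hq ha hb hab
        simp only [Set.mem_ofPred_eq]
        convert! this using 1
        ext1
        · simp
        · simp only [Prod.snd_add, Prod.smul_snd, smul_eq_mul]
          linear_combination (-c) * hab
    exact fun p hp => this hp
  have hup' : ∀ (x : X) (s t : ℝ), (x, s) ∈ H → s ≤ t → (x, t) ∈ H := by
    intro x s t hs hst
    have := hup (t - s) (by linarith) _ hs
    simpa using this
  have hstep : ∀ (S : X × ℝ), (∀ p ∈ E, ((1 / 2 : ℝ) • (p.1 + S.1),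
      (p.2 + S.2) / 2 - δ / 2 * (‖p.1 - S.1‖ - ε)) ∈ H) → ∀ p ∈ H, ((1 / 2 : ℝ) • (p.1 + S.1),
      (p.2 + S.2) / 2 - δ / 2 * (‖p.1 - S.1‖ - ε)) ∈ H := by
    intro S hS
    have : H ⊆ {p : X × ℝ | ((1 / 2 : ℝ) • (p.1 + S.1),
      (p.2 + S.2) / 2 - δ / 2 * (‖p.1 - S.1‖ - ε)) ∈ H} := by
      apply convexHull_min hS
      intro p hp q hq a b ha hb hab
      have := hHc hp hq ha hb hab
      change ((1 / 2 : ℝ) • ((a • p + b • q).1 + S.1),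
        ((a • p + b • q).2 + S.2) / 2 - δ / 2 * (‖(a • p + b • q).1 - S.1‖ - ε)) ∈ H
      have e1 : a • p.1 + b • q.1 - S.1 = a • (p.1 - S.1) + b • (q.1 - S.1) := by
        rw [smul_sub, smul_sub, sub_add_sub_comm, ← add_smul, hab, one_smul]
      have e2 : ‖a • p.1 + b • q.1 - S.1‖ ≤ a * ‖p.1 - S.1‖ + b * ‖q.1 - S.1‖ := by
        rw [e1]
        refine (norm_add_le _ _).trans ?_
        rw [norm_smul, norm_smul, Real.norm_eq_abs, Real.norm_eq_abs, abs_of_nonneg ha,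
          abs_of_nonneg hb]
      have e3 : (1 / 2 : ℝ) • (a • p.1 + b • q.1 + S.1) =
          a • ((1 / 2 : ℝ) • (p.1 + S.1)) + b • ((1 / 2 : ℝ) • (q.1 + S.1)) := by
        have : S.1 = (a + b) • S.1 := by rw [hab, one_smul]
        conv_lhs => rw [this]
        module
      refine hup' _ (a * ((p.2 + S.2) / 2 - δ / 2 * (‖p.1 - S.1‖ - ε)) +
        b * ((q.2 + S.2) / 2 - δ / 2 * (‖q.1 - S.1‖ - ε))) _ ?_ ?_
      · convert! this using 1
        ext1
        · exact e3
        · simp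
      · simp only [Prod.snd_add, Prod.smul_snd, smul_eq_mul, Prod.fst_add, Prod.smul_fst]
        have hb' : b = 1 - a := by linarith
        have := mul_le_mul_of_nonneg_left e2 hδ.le
        subst hb'
        linarith
    exact fun p hp => this hp
  have hmid : ∀ p ∈ E, ∀ q ∈ E, ((1 / 2 : ℝ) • (p.1 + q.1),
      (p.2 + q.2) / 2 - δ / 2 * (‖p.1 - q.1‖ - ε)) ∈ H := by
    intro p hp q hq
    by_cases hpq : ε ≤ ‖p.1 - q.1‖
    · have := hgain p.1 hp.1 q.1 hq.1 hpq
      apply hEH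
      refine ⟨?_, ?_⟩
      · simp only [smul_add]
        exact convex_closedBall (0 : X) 1 hp.1 hq.1 (by norm_num) (by norm_num) (by norm_num)
      · have h1 := hp.2
        have h2 := hq.2
        have h3 := norm_sub_le p.1 q.1
        have h4 := mem_closedBall_zero_iff.1 hp.1
        have h5 := mem_closedBall_zero_iff.1 hq.1
        simp only
        nlinarith
    · push Not at hpq
      have := hHc (hEH hp) (hEH hq) (show (0 : ℝ) ≤ 1 / 2 by norm_num)
        (show (0 : ℝ) ≤ 1 / 2 by norm_num) (by norm_num)
      refine hup' _ ((p.2 + q.2) / 2) _ ?_ (by nlinarith)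
      convert! this using 1
      ext1
      · simp
      · simp; ring
  have hmidH : ∀ p ∈ H, ∀ q ∈ H, ((1 / 2 : ℝ) • (p.1 + q.1),
      (p.2 + q.2) / 2 - δ / 2 * (‖p.1 - q.1‖ - ε)) ∈ H := by
    intro p hp q hq
    refine hstep q ?_ p hp
    intro p' hp'
    have := hstep p' (fun q' hq' => hmid q' hq' p' hp') q hq
    rwa [add_comm q.1, add_comm q.2, norm_sub_rev] at this
  let g : X → ℝ := fun x => sInf {t | (x, t) ∈ H}
  have hbdd : ∀ x, BddBelow {t | (x, t) ∈ H} := fun x => ⟨0, fun t ht => hH0 _ ht⟩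
  have hmem1 : ∀ x ∈ closedBall (0 : X) 1, (x, (1 : ℝ)) ∈ H := fun x hx =>
    hEH ⟨hx, (hφ x).2⟩
  have hlt : ∀ x ∈ closedBall (0 : X) 1, ∀ η > (0 : ℝ), (x, g x + η) ∈ H := by
    intro x hx η hη
    obtain ⟨t, ht, ht2⟩ := exists_lt_of_csInf_lt (s := {t | (x, t) ∈ H}) ⟨1, hmem1 x hx⟩
      (show g x < g x + η by linarith)
    exact hup' x t _ ht ht2.le
  have hle : ∀ x t, (x, t) ∈ H → g x ≤ t := fun x t ht => csInf_le (hbdd x) ht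
  refine ⟨g, ?_, ?_, δ / 2 * ε, by positivity, ?_⟩
  · intro x hx
    exact ⟨le_csInf ⟨1, hmem1 x hx⟩ (fun t ht => hH0 _ ht), hle x 1 (hmem1 x hx)⟩
  · intro x hx y hy a b ha hb hab
    apply le_of_forall_pos_le_add
    intro η hη
    have := hHc (hlt x hx η hη) (hlt y hy η hη) ha hb hab
    have := hle (a • x + b • y) (a * (g x + η) + b * (g y + η)) this
    calc _ ≤ _ := this
      _ = a * g x + b * g y + η := by linear_combination η * hab
  · intro x hx y hy hxy
    apply le_of_forall_pos_le_add
    intro η hη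
    have := hle _ _ (hmidH _ (hlt x hx η hη) _ (hlt y hy η hη))
    have h5 := mul_le_mul_of_nonneg_left hxy hδ.le
    linarith

lemma exists_even (ε : ℝ) (hε : 0 < ε) (n : ℕ)
    (h : ¬ (tree ε (closedBall (0 : X) 1) n).Nonempty) :
    ∃ g : X → ℝ, (∀ x ∈ closedBall (0 : X) 1, 0 ≤ g x ∧ g x ≤ 1) ∧
      (∀ x ∈ closedBall (0 : X) 1, ∀ y ∈ closedBall (0 : X) 1, ∀ a b : ℝ, 0 ≤ a → 0 ≤ b →
        a + b = 1 → g (a • x + b • y) ≤ a * g x + b * g y) ∧ (∀ x, g (-x) = g x) ∧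
      ∃ δ > (0 : ℝ), ∀ x ∈ closedBall (0 : X) 1,
      ∀ y ∈ closedBall (0 : X) 1, 2 * ε ≤ ‖x - y‖ →
        g ((1 / 2 : ℝ) • (x + y)) ≤ (g x + g y) / 2 - δ := by
  obtain ⟨g, h1, h2, δ, hδ, h3⟩ := exists_hull ε hε n h
  have hneg : ∀ x ∈ closedBall (0 : X) 1, -x ∈ closedBall (0 : X) 1 := by
    intro x hx; simpa using hx
  refine ⟨fun x => (g x + g (-x)) / 2, ?_, ?_, ?_, δ, hδ, ?_⟩
  · intro x hx
    have a1 := h1 x hx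
    have a2 := h1 _ (hneg x hx)
    constructor <;> linarith [a1.1, a1.2, a2.1, a2.2]
  · intro x hx y hy a b ha hb hab
    have a1 := h2 x hx y hy a b ha hb hab
    have a2 := h2 _ (hneg x hx) _ (hneg y hy) a b ha hb hab
    have e : -(a • x + b • y) = a • (-x) + b • (-y) := by module
    simp only [e]
    linarith
  · intro x; simp only [neg_neg]; ring
  · intro x hx y hy hxy
    have a1 := h3 x hx y hy hxy
    have a2 := h3 _ (hneg x hx) _ (hneg y hy) (by
      rwa [show -x - -y = -(x - y) by abel, norm_neg])
    have e : -((1 / 2 : ℝ) • (x + y)) = (1 / 2 : ℝ) • (-x + -y) := by module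
    simp only [e]
    linarith

lemma exists_G (H : ∀ ε > (0 : ℝ), ∃ n, ¬ (tree ε (closedBall (0 : X) 1) n).Nonempty) :
    ∃ g : X → ℝ, (∀ x ∈ closedBall (0 : X) 1, 0 ≤ g x ∧ g x ≤ 1) ∧
      (∀ x ∈ closedBall (0 : X) 1, ∀ y ∈ closedBall (0 : X) 1, ∀ a b : ℝ, 0 ≤ a → 0 ≤ b →
        a + b = 1 → g (a • x + b • y) ≤ a * g x + b * g y) ∧ (∀ x, g (-x) = g x) ∧
      ∀ ε > (0 : ℝ), ∃ δ > (0 : ℝ), ∀ x ∈ closedBall (0 : X) 1,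
      ∀ y ∈ closedBall (0 : X) 1, ε ≤ ‖x - y‖ →
        g ((1 / 2 : ℝ) • (x + y)) ≤ (g x + g y) / 2 - δ := by
  have hex : ∀ k : ℕ, _ := fun k : ℕ =>
    exists_even (X := X) ((1 / 2 : ℝ) ^ k) (by positivity) _
      (H ((1 / 2 : ℝ) ^ k) (by positivity)).choose_spec
  choose g h1 h2 h3 δ hδ h4 using hex
  have hc : HasSum (fun k : ℕ => (1 / 2 : ℝ) / 2 ^ k) 1 := by
    have := hasSum_geometric_two' (1 : ℝ)
    simpa using this
  have hcs := hc.summable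
  have hc0 : ∀ k : ℕ, (0 : ℝ) < 1 / 2 / 2 ^ k := fun k => by positivity
  have hsum : ∀ x ∈ closedBall (0 : X) 1, Summable (fun k => (1 / 2 : ℝ) / 2 ^ k * g k x) := by
    intro x hx
    refine Summable.of_nonneg_of_le (fun k => mul_nonneg (hc0 k).le (h1 k x hx).1) (fun k => ?_) hcs
    exact mul_le_of_le_one_right (hc0 k).le (h1 k x hx).2
  have hB := convex_closedBall (0 : X) 1
  refine ⟨fun x => ∑' k, (1 / 2 : ℝ) / 2 ^ k * g k x, ?_, ?_, ?_, ?_⟩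
  · intro x hx
    refine ⟨tsum_nonneg (fun k => mul_nonneg (hc0 k).le (h1 k x hx).1), ?_⟩
    have := (hsum x hx).tsum_le_tsum
      (fun k => mul_le_of_le_one_right (hc0 k).le (h1 k x hx).2) hcs
    rwa [hc.tsum_eq] at this
  · intro x hx y hy a b ha hb hab
    beta_reduce
    rw [← tsum_mul_left, ← tsum_mul_left, ← ((hsum x hx).mul_left a).tsum_add
      ((hsum y hy).mul_left b)]
    refine (hsum _ (hB hx hy ha hb hab)).tsum_le_tsum (fun k => ?_)
      (((hsum x hx).mul_left a).add ((hsum y hy).mul_left b))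
    have := mul_le_mul_of_nonneg_left (h2 k x hx y hy a b ha hb hab) (hc0 k).le
    linarith
  · intro x; simp only [h3]
  · intro ε hε
    obtain ⟨k0, hk0⟩ := exists_pow_lt_of_lt_one (show 0 < ε / 2 by positivity)
      (show (1 / 2 : ℝ) < 1 by norm_num)
    refine ⟨(1 / 2 : ℝ) / 2 ^ k0 * δ k0, mul_pos (hc0 _) (hδ _), ?_⟩
    intro x hx y hy hxy
    have hm : (1 / 2 : ℝ) • (x + y) ∈ closedBall (0 : X) 1 := by
      rw [smul_add]
      exact hB hx hy (by norm_num) (by norm_num) (by norm_num)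
    have s1 : HasSum (fun k => if k = k0 then (1 / 2 : ℝ) / 2 ^ k0 * δ k0 else 0)
      ((1 / 2 : ℝ) / 2 ^ k0 * δ k0) := hasSum_ite_eq k0 _
    have s2 := ((hsum _ hm).hasSum).add s1
    have s3 := (((hsum x hx).hasSum).add ((hsum y hy).hasSum)).div_const 2
    have := hasSum_le (fun k => ?_) s2 s3
    · beta_reduce; linarith
    · have e0 : g k ((1 / 2 : ℝ) • (x + y)) ≤ (g k x + g k y) / 2 := by
        have := h2 k x hx y hy (1 / 2) (1 / 2) (by norm_num) (by norm_num) (by norm_num)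
        rw [smul_add]; linarith
      by_cases hk : k = k0
      · subst hk
        simp only [if_true]
        have := mul_le_mul_of_nonneg_left (h4 k x hx y hy (by linarith)) (hc0 k).le
        linarith
      · simp only [hk, if_false]
        have := mul_le_mul_of_nonneg_left e0 (hc0 k).le
        linarith

end
end LampProof

namespace LampProof
section
open Metric
variable {X : Type*} [NormedAddCommGroup X] [NormedSpace ℝ X]

lemma uc_of_G (g : X → ℝ) (h1 : ∀ x ∈ closedBall (0 : X) 1, 0 ≤ g x ∧ g x ≤ 1)
    (h2 : ∀ x ∈ closedBall (0 : X) 1, ∀ y ∈ closedBall (0 : X) 1, ∀ a b : ℝ, 0 ≤ a → 0 ≤ b →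
        a + b = 1 → g (a • x + b • y) ≤ a * g x + b * g y) (h3 : ∀ x, g (-x) = g x)
    (h4 : ∀ ε > (0 : ℝ), ∃ δ > (0 : ℝ), ∀ x ∈ closedBall (0 : X) 1,
      ∀ y ∈ closedBall (0 : X) 1, ε ≤ ‖x - y‖ →
        g ((1 / 2 : ℝ) • (x + y)) ≤ (g x + g y) / 2 - δ) : HasEquivUnifConvexNorm X := by
  let U : Set X := {x | x ∈ closedBall (0 : X) 1 ∧ ‖x‖ + g x / 4 ≤ 3 / 4}
  have hB := convex_closedBall (0 : X) 1
  have hnrm : ∀ (x y : X) (a b : ℝ), 0 ≤ a → 0 ≤ b → ‖a • x + b • y‖ ≤ a * ‖x‖ + b * ‖y‖ := by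
    intro x y a b ha hb
    refine (norm_add_le _ _).trans ?_
    rw [norm_smul, norm_smul, Real.norm_eq_abs, Real.norm_eq_abs, abs_of_nonneg ha,
      abs_of_nonneg hb]
  have hUc : Convex ℝ U := by
    intro x hx y hy a b ha hb hab
    refine ⟨hB hx.1 hy.1 ha hb hab, ?_⟩
    have e1 := hnrm x y a b ha hb
    have e2 := h2 x hx.1 y hy.1 a b ha hb hab
    have e3 := mul_le_mul_of_nonneg_left hx.2 ha
    have e4 := mul_le_mul_of_nonneg_left hy.2 hb
    have hb' : b = 1 - a := by linarith
    subst hb'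
    linarith
  have hUs : ∀ x ∈ U, -x ∈ U := by
    intro x hx
    refine ⟨by simpa using hx.1, ?_⟩
    rw [norm_neg, h3]; exact hx.2
  have hbU : ball (0 : X) (1 / 2) ⊆ U := by
    intro x hx
    rw [mem_ball_zero_iff] at hx
    have hx1 : x ∈ closedBall (0 : X) 1 := by rw [mem_closedBall_zero_iff]; linarith
    refine ⟨hx1, ?_⟩
    have := (h1 x hx1).2
    linarith
  have hUb : U ⊆ closedBall (0 : X) (3 / 4) := by
    intro x hx
    rw [mem_closedBall_zero_iff]
    have := (h1 x hx.1).1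
    have := hx.2
    linarith
  have habs : Absorbent ℝ U := absorbent_nhds_zero
    (Filter.mem_of_superset (ball_mem_nhds 0 (by norm_num)) hbU)
  have h0U : (0 : X) ∈ U := hbU (by simp)
  have hlow : ∀ x, ‖x‖ / (3 / 4) ≤ gauge U x := fun x =>
    le_gauge_of_subset_closedBall habs (by norm_num) hUb
  have hupp : ∀ x, gauge U x ≤ 2 * ‖x‖ := by
    intro x
    have := gauge_mono (absorbent_nhds_zero (ball_mem_nhds (0 : X) (show (0 : ℝ) < 1 / 2 by norm_num)))
      hbU x
    rw [gauge_ball (by norm_num)] at this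
    linarith
  have hhom : ∀ (c : ℝ) (x : X), gauge U (c • x) = |c| * gauge U x := by
    intro c x
    rcases le_total 0 c with hc | hc
    · rw [gauge_smul_of_nonneg hc, abs_of_nonneg hc, smul_eq_mul]
    · rw [← gauge_neg hUs, ← neg_smul, gauge_smul_of_nonneg (by linarith), abs_of_nonpos hc,
        smul_eq_mul]
  -- dilation
  have hdil : ∀ (m : X) (t : ℝ), 0 < t → t ≤ 1 / 3 → m ∈ closedBall (0 : X) (3 / 4) →
      ‖m‖ + g m / 4 ≤ 3 / 4 - 3 / 2 * t → gauge U m ≤ 1 / (1 + t) := by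
    intro m t ht ht3 hm hΦ
    rw [mem_closedBall_zero_iff] at hm
    have hm1 : m ∈ closedBall (0 : X) 1 := by rw [mem_closedBall_zero_iff]; linarith
    have hw : (4 / 3 : ℝ) • m ∈ closedBall (0 : X) 1 := by
      rw [mem_closedBall_zero_iff, norm_smul, Real.norm_eq_abs, abs_of_nonneg (by norm_num)]
      linarith
    have e : (1 + t) • m = (1 - 3 * t) • m + (3 * t) • ((4 / 3 : ℝ) • m) := by module
    have hmem : (1 + t) • m ∈ U := by
      refine ⟨?_, ?_⟩
      · rw [e]; exact hB hm1 hw (by linarith) (by linarith) (by ring)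
      · have e1 := h2 m hm1 _ hw (1 - 3 * t) (3 * t) (by linarith) (by linarith) (by ring)
        rw [← e] at e1
        have e2 := (h1 _ hw).2
        have e3 := (h1 _ hm1).1
        rw [norm_smul, Real.norm_eq_abs, abs_of_nonneg (by linarith)]
        nlinarith
    have := gauge_le_one_of_mem hmem
    rw [hhom, abs_of_pos (by linarith)] at this
    rw [le_div_iff₀ (by linarith)]
    linarith
  refine ⟨gauge U, ?_, hhom, gauge_add_le hUc habs, ⟨1, one_pos, 2, two_pos, ?_⟩, ?_⟩
  · intro x
    constructor
    · intro h
      have := hlow x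
      rw [h] at this
      have : ‖x‖ ≤ 0 := by linarith
      exact norm_le_zero_iff.1 this
    · rintro rfl; exact gauge_zero
  · intro x
    have := hlow x
    have := norm_nonneg x
    exact ⟨by linarith, hupp x⟩
  · intro ε hε
    obtain ⟨δ₀, hδ₀, hgain⟩ := h4 (ε / 4) (by positivity)
    set t := min δ₀ 1 / 6 with ht
    have hmin : 0 < min δ₀ 1 := lt_min hδ₀ one_pos
    have hm1 : min δ₀ 1 ≤ δ₀ := min_le_left _ _
    have hm2 : min δ₀ 1 ≤ 1 := min_le_right _ _
    have ht0 : 0 < t := by positivity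
    refine ⟨t, ht0, fun x y hx hy hxy => ?_⟩
    have key : ∀ s : ℝ, 1 / 2 ≤ s → s < 1 → s * gauge U (x + y) ≤ 2 / (1 + t) := by
      intro s hs1 hs2
      have hmem : ∀ z, gauge U z ≤ 1 → s • z ∈ U := by
        intro z hz
        apply setOfPred_gauge_lt_one_subset_self hUc h0U habs
        change gauge U (s • z) < 1
        rw [hhom, abs_of_nonneg (by linarith)]
        nlinarith [gauge_nonneg (s := U) z]
      have hsx := hmem x hx
      have hsy := hmem y hy
      have hd : ε / 4 ≤ ‖s • x - s • y‖ := by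
        rw [← smul_sub, norm_smul, Real.norm_eq_abs, abs_of_nonneg (by linarith)]
        have := hupp (x - y)
        nlinarith
      have hg := hgain _ hsx.1 _ hsy.1 hd
      have hn : ‖(1 / 2 : ℝ) • (s • x + s • y)‖ ≤ 1 / 2 * ‖s • x‖ + 1 / 2 * ‖s • y‖ := by
        rw [smul_add]
        exact hnrm _ _ _ _ (by norm_num) (by norm_num)
      have hmm : (1 / 2 : ℝ) • (s • x + s • y) ∈ closedBall (0 : X) (3 / 4) := by
        rw [mem_closedBall_zero_iff]
        have a1 := mem_closedBall_zero_iff.1 (hUb hsx)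
        have a2 := mem_closedBall_zero_iff.1 (hUb hsy)
        linarith
      have a1 := hsx.2
      have a2 := hsy.2
      have := hdil _ t ht0 (by linarith) hmm (by linarith)
      rw [← smul_add, smul_smul, hhom, abs_of_nonneg (by linarith)] at this
      have e : 2 / (1 + t) = 2 * (1 / (1 + t)) := by ring
      rw [e]; linarith
    have hb : 2 / (1 + t) ≤ 2 - t := by
      rw [div_le_iff₀ (by linarith)]
      nlinarith
    refine le_trans ?_ hb
    by_contra hcon
    push Not at hcon
    set A := gauge U (x + y)
    set b := 2 / (1 + t)
    have hb0 : 0 < b := by positivity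
    have hA0 : 0 < A := by linarith
    have hr : b / A < 1 := by rw [div_lt_one hA0]; exact hcon
    have k1 := key (max (1 / 2) ((b / A + 1) / 2)) (le_max_left _ _) (max_lt (by norm_num) (by linarith))
    have k2 := mul_le_mul_of_nonneg_right (le_max_right (1 / 2 : ℝ) ((b / A + 1) / 2)) hA0.le
    have k3 : (b / A + 1) / 2 * A = (b + A) / 2 := by field_simp
    linarith

theorem embed_of_not_uc (X : Type*) [NormedAddCommGroup X] [NormedSpace ℝ X]
    (h : ¬ HasEquivUnifConvexNorm X) : JData X := by
  by_contra hJ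
  apply h
  obtain ⟨g, h1, h2, h3, h4⟩ := exists_G (X := X) (by
    intro ε hε
    by_contra hc
    push Not at hc
    exact hJ (jdata_of_tree ε hε hc))
  exact uc_of_G g h1 h2 h3 h4

end
end LampProof

/-- A Banach space is non-superreflexive iff the finite lamplighter groups
`Z₂ ≀ Z_n` (with word metric w.r.t. `{t, ta}`) embed into it with uniformly
bounded distortion. -/
theorem nonsuperreflexive_iff_lamplighters_embed
    (X : Type*) [NormedAddCommGroup X] [NormedSpace ℝ X] [CompleteSpace X] :
    (¬ HasEquivUnifConvexNorm X) ↔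
      ∃ D : ℝ, 1 ≤ D ∧ ∀ n : ℕ, 2 ≤ n →
        ∃ (f : Lamp n → X) (r : ℝ), 0 < r ∧
          ∀ u v : Lamp n,
            r * (lampDist n u v : ℝ) ≤ ‖f u - f v‖ ∧
            ‖f u - f v‖ ≤ D * r * (lampDist n u v : ℝ) := by
  constructor
  · intro h
    exact LampProof.embed_of_jdata X (LampProof.embed_of_not_uc X h)
  · rintro ⟨D, hD, H⟩
    exact LampProof.not_unifConvex_of_embed X D hD H
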